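/- Let m, d ≥ 1 be integers and let ω ∈ ℝ^d satisfy ω·ν ≠ 0 for every nonzero ν ∈ ℤ^d. Let Γ be a symmetric positive definite real m×m matrix, let V : ℝ^m → ℝ be real analytic with g = ∇V, and let f : ℝ^d → ℝ^m be (2πℤ)^d-periodic and real analytic with mean f₀. Suppose c ∈ ℝ^m satisfies g(c) = f₀ and the Hessian matrix of V at c is positive definite. Then there exists ε₀ > 0 such that for every ε ∈ (0, ε₀) there is a real analytic, (2πℤ)^d-periodic function X_ε : ℝ^d → ℝ^m such that x(t) := c + X_ε(ωt) satisfies ε x''(t) + Γ x'(t) + ε g(x(t)) = ε f(ωt) for all t ∈ ℝ; moreover sup_{ψ∈ℝ^d} |X_ε(ψ)| → 0 as ε → 0⁺. -/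

import Mathlib

open scoped Real
open Filter

noncomputable section

/-- The mean of a `(2πℤ)^d`-periodic function over the fundamental box `[0,2π]^d`. -/
def boxMean (d m : ℕ) (F : (Fin d → ℝ) → (Fin m → ℝ)) : Fin m → ℝ :=
  ((2 * π)⁻¹ ^ d) • ∫ ψ in Set.univ.pi fun _ : Fin d => Set.Icc (0 : ℝ) (2 * π), F ψ

/-- `(2πℤ)^d`-periodicity. -/
def IsPeriodic2pi (d m : ℕ) (F : (Fin d → ℝ) → (Fin m → ℝ)) : Prop :=
  ∀ (ψ : Fin d → ℝ) (k : Fin d → ℤ), F (fun j => ψ j + 2 * π * k j) = F ψ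

/-- The Hessian matrix of `V : ℝ^m → ℝ` at the point `c`. -/
def hessianMatrix (m : ℕ) (V : (Fin m → ℝ) → ℝ) (c : Fin m → ℝ) :
    Matrix (Fin m) (Fin m) ℝ :=
  Matrix.of fun i j => iteratedFDeriv ℝ 2 V c ![Pi.single i 1, Pi.single j 1]

namespace QPR

open scoped BoundedContinuousFunction
open MeasureTheory Set Topology

section Linear

variable {E : Type*} [NormedAddCommGroup E] [NormedSpace ℝ E] [CompleteSpace E]

/-- Exponential stability of the flow generated by minus B. -/
def Stable (B : E →L[ℝ] E) (C β : ℝ) : Prop :=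
  0 < β ∧ 0 ≤ C ∧ ∀ s : ℝ, 0 ≤ s → ∀ v : E,
    ‖NormedSpace.exp (s • (-B)) v‖ ≤ C * Real.exp (-(β * s)) * ‖v‖

lemma hasDerivAt_flow (B : E →L[ℝ] E) (v : E) (t : ℝ) :
    HasDerivAt (fun s : ℝ => NormedSpace.exp (s • B) v) (B (NormedSpace.exp (t • B) v)) t := by
  have h := hasDerivAt_exp_smul_const' (𝕂 := ℝ) B t
  have := h.clm_apply (hasDerivAt_const t v)
  simpa using this

lemma flow_add (B : E →L[ℝ] E) (s t : ℝ) :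
    NormedSpace.exp ((s + t) • B) = NormedSpace.exp (s • B) * NormedSpace.exp (t • B) := by
  letI : NormedAlgebra ℚ (E →L[ℝ] E) := NormedAlgebra.restrictScalars ℚ ℝ (E →L[ℝ] E)
  rw [add_smul]
  refine NormedSpace.exp_add_of_commute ?_
  exact ((Commute.refl B).smul_left s).smul_right t

lemma flow_neg (B : E →L[ℝ] E) (s : ℝ) (v : E) :
    NormedSpace.exp (s • B) (NormedSpace.exp (s • (-B)) v) = v := by
  have h := flow_add B s (-s)
  rw [add_neg_cancel, zero_smul, NormedSpace.exp_zero] at h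
  rw [smul_neg, ← neg_smul, ← mul_apply_eq_comp, ← h]
  rfl

lemma stable_of_form (B : E →L[ℝ] E) (P : E →L[ℝ] E →L[ℝ] ℝ) (hP : ∀ u v, P u v = P v u)
    {κ β : ℝ} (hκ : 0 < κ) (hβ : 0 < β) (hlow : ∀ u, κ * ‖u‖ ^ 2 ≤ P u u)
    (hB : ∀ u, β * P u u ≤ P (B u) u) : Stable B (Real.sqrt (‖P‖ / κ)) β := by
  refine ⟨hβ, Real.sqrt_nonneg _, fun s hs v => ?_⟩
  set u : ℝ → E := fun s => NormedSpace.exp (s • (-B)) v with hu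
  have hder : ∀ t, HasDerivAt u (-(B (u t))) t := fun t => by
    exact (hasDerivAt_flow (-B) v t).congr_deriv (neg_apply _ _)
  set φ : ℝ → ℝ := fun t => Real.exp (2 * β * t) * P (u t) (u t) with hφ
  have hφd : ∀ t, HasDerivAt φ (Real.exp (2 * β * t) * (2 * β) * P (u t) (u t) +
      Real.exp (2 * β * t) * (-(2 * P (B (u t)) (u t)))) t := fun t => by
    have h1 : HasDerivAt (fun t : ℝ => Real.exp (2 * β * t)) (Real.exp (2 * β * t) * (2 * β)) t := by
      have := ((hasDerivAt_id t).const_mul (2 * β)).exp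
      simpa using this
    have h2 : HasDerivAt (fun t => P (u t) (u t)) (-(2 * P (B (u t)) (u t))) t := by
      have h3 : HasDerivAt (fun t => P (u t)) (P (-(B (u t)))) t :=
        P.hasFDerivAt.comp_hasDerivAt t (hder t)
      have := h3.clm_apply (hder t)
      refine this.congr_deriv ?_
      simp only [map_neg, neg_apply]
      rw [hP (u t) (B (u t))]
      ring
    exact h1.mul h2
  have hanti : Antitone φ := by
    refine antitone_of_deriv_nonpos (fun t => (hφd t).differentiableAt) (fun t => ?_)
    rw [(hφd t).deriv]
    have h1 := hB (u t)
    have h2 := Real.exp_pos (2 * β * t)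
    nlinarith
  have h0 := hanti hs
  have hu0 : u 0 = v := by simp [hu]
  simp only [hφ, hu0, mul_zero, Real.exp_zero, one_mul] at h0
  have hPv : P v v ≤ ‖P‖ * ‖v‖ ^ 2 := by
    have := (le_abs_self _).trans (P.le_opNorm₂ v v)
    rw [pow_two, ← mul_assoc]; exact this
  have h1 : Real.exp (2 * β * s) * (κ * ‖u s‖ ^ 2) ≤ ‖P‖ * ‖v‖ ^ 2 :=
    (mul_le_mul_of_nonneg_left (hlow (u s)) (Real.exp_pos _).le).trans (h0.trans hPv)
  have h2 : Real.exp (2 * β * s) = (Real.exp (β * s)) ^ 2 := by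
    rw [← Real.exp_nat_mul]; push_cast; ring_nf
  have h3 : (Real.exp (β * s) * ‖u s‖) ^ 2 ≤ (‖P‖ / κ) * ‖v‖ ^ 2 := by
    rw [div_mul_eq_mul_div, le_div_iff₀ hκ]
    rw [h2] at h1
    nlinarith
  have h4 : Real.exp (β * s) * ‖u s‖ ≤ Real.sqrt (‖P‖ / κ) * ‖v‖ := by
    have := Real.abs_le_sqrt h3
    rw [Real.sqrt_mul' _ (sq_nonneg _), Real.sqrt_sq (norm_nonneg _)] at this
    exact (le_abs_self _).trans this
  have h5 : ‖u s‖ = Real.exp (-(β * s)) * (Real.exp (β * s) * ‖u s‖) := by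
    rw [← mul_assoc, ← Real.exp_add]; simp
  change ‖u s‖ ≤ _
  rw [h5]
  calc _ ≤ Real.exp (-(β * s)) * (Real.sqrt (‖P‖ / κ) * ‖v‖) := by gcongr
    _ = _ := by ring

lemma bounded_unique {B : E →L[ℝ] E} {C β : ℝ} (hB : Stable B C β) (y : ℝ → E) (M : ℝ)
    (hM : ∀ t, ‖y t‖ ≤ M) (hy : ∀ t, HasDerivAt y (-(B (y t))) t) (t : ℝ) : y t = 0 := by
  obtain ⟨hβ, hC, hS⟩ := hB
  -- `exp (tB) y t` is constant
  have hconst : ∀ s, NormedSpace.exp (s • B) (y s) = y 0 := by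
    have hd : ∀ s, HasDerivAt (fun s : ℝ => NormedSpace.exp (s • B) (y s)) 0 s := fun s => by
      have h1 := hasDerivAt_exp_smul_const (𝕂 := ℝ) B s
      have := h1.clm_apply (hy s)
      simpa using this
    intro s
    have := is_const_of_deriv_eq_zero (fun s => (hd s).differentiableAt)
      (fun s => (hd s).deriv) s 0
    simpa using this
  have hrel : ∀ s, 0 ≤ s → ‖y t‖ ≤ C * Real.exp (-(β * s)) * M := by
    intro s hs
    have h1 : y t = NormedSpace.exp (s • (-B)) (y (t - s)) := by
      have e1 : NormedSpace.exp (t • B) (y t) = NormedSpace.exp ((t - s) • B) (y (t - s)) := by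
        rw [hconst, hconst]
      have e2 : NormedSpace.exp ((-t) • B) (NormedSpace.exp (t • B) (y t)) = y t := by
        have := flow_neg (-B) t (y t)
        simpa using this
      rw [← e2, e1, ← mul_apply_eq_comp, ← flow_add]
      congr 2
      rw [smul_neg, ← neg_smul]
      congr 1; ring
    rw [h1]
    exact (hS s hs _).trans (by gcongr; exact hM _)
  have hlim : Tendsto (fun s : ℝ => C * Real.exp (-(β * s)) * M) atTop (𝓝 (C * 0 * M)) := by
    refine ((Real.tendsto_exp_neg_atTop_nhds_zero.comp ?_).const_mul C).mul_const M
    exact tendsto_id.const_mul_atTop hβ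
  have : ‖y t‖ ≤ C * 0 * M :=
    ge_of_tendsto hlim (by filter_upwards [eventually_ge_atTop 0] with s hs using hrel s hs)
  simpa using this

lemma exists_bounded {B : E →L[ℝ] E} {C β : ℝ} (hB : Stable B C β) (k : ℝ →ᵇ E) :
    ∃ y : ℝ →ᵇ E, ‖y‖ ≤ C / β * ‖k‖ ∧ ∀ t, HasDerivAt y (k t - B (y t)) t := by
  obtain ⟨hβ, hC, hS⟩ := hB
  set h : ℝ → E := fun s => NormedSpace.exp (s • B) (k s) with hh
  have hexpc : Continuous fun s : ℝ => NormedSpace.exp (s • B) :=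
    (differentiable_exp_smul_const ℝ B).continuous
  have hcont : Continuous h := hexpc.clm_apply k.continuous
  have hint0 : IntegrableOn (fun s => Real.exp (β * s)) (Iic 0) := by
    exact integrableOn_exp_mul_Iic hβ 0
  have hInt : ∀ t, IntegrableOn h (Iic t) := by
    have h0 : IntegrableOn h (Iic 0) := by
      refine Integrable.mono' (hint0.const_mul (C * ‖k‖)) hcont.aestronglyMeasurable ?_
      rw [ae_restrict_iff' measurableSet_Iic]
      refine Eventually.of_forall fun s hs => ?_
      have := hS (-s) (by simpa using hs) (k s)
      rw [smul_neg, neg_smul, neg_neg] at this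
      refine this.trans ?_
      have h2 := k.norm_coe_le_norm s
      rw [show -(β * -s) = β * s by ring]
      calc C * Real.exp (β * s) * ‖k s‖ ≤ C * Real.exp (β * s) * ‖k‖ := by gcongr
        _ = _ := by ring
    intro t
    have h1 : IntegrableOn h (Icc 0 t) := hcont.integrableOn_Icc
    refine (h0.union h1).mono_set ?_
    intro s hs
    rcases le_total s 0 with h | h
    · exact Or.inl h
    · exact Or.inr ⟨h, hs⟩
  set J : ℝ → E := fun t => ∫ s in Iic t, h s with hJ
  have hJd : ∀ t, HasDerivAt J (h t) t := by
    intro t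
    have e : J = fun t => (∫ s in Iic (0:ℝ), h s) + ∫ s in (0:ℝ)..t, h s := by
      funext t
      have := intervalIntegral.integral_Iic_sub_Iic (hInt 0) (hInt t)
      rw [← this]; simp [hJ]
    rw [e]
    exact (hcont.integral_hasStrictDerivAt 0 t).hasDerivAt.const_add _
  set y : ℝ → E := fun t => NormedSpace.exp (t • (-B)) (J t) with hy
  have hyd : ∀ t, HasDerivAt y (k t - B (y t)) t := by
    intro t
    have h1 := hasDerivAt_exp_smul_const' (𝕂 := ℝ) (-B) t
    have h2 := h1.clm_apply (hJd t)
    convert h2 using 1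
    have h3 := flow_neg (-B) t (k t)
    rw [neg_neg] at h3
    simp only [hh, h3, hy]
    simp
    abel
  have hbound : ∀ t, ‖y t‖ ≤ C / β * ‖k‖ := by
    intro t
    have e : y t = ∫ s in Iic t, NormedSpace.exp (t • (-B)) (h s) :=
      (ContinuousLinearMap.integral_comp_comm _ (hInt t)).symm
    have hg : IntegrableOn (fun s => C * ‖k‖ * (Real.exp (-(β * t)) * Real.exp (β * s))) (Iic t) :=
      ((integrableOn_exp_mul_Iic hβ t).const_mul _).const_mul _
    have hle : ‖y t‖ ≤ ∫ s in Iic t, C * ‖k‖ * (Real.exp (-(β * t)) * Real.exp (β * s)) := by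
      rw [e]
      refine norm_integral_le_of_norm_le hg ?_
      rw [ae_restrict_iff' measurableSet_Iic]
      refine Eventually.of_forall fun s hs => ?_
      have e2 : NormedSpace.exp (t • (-B)) (h s) = NormedSpace.exp ((t - s) • (-B)) (k s) := by
        simp only [hh]
        rw [← mul_apply_eq_comp]
        have : s • B = (-s) • (-B) := by simp
        rw [this, ← flow_add]
        rfl
      rw [e2]
      refine (hS (t - s) (sub_nonneg.2 hs) _).trans ?_
      have h2 := k.norm_coe_le_norm s
      rw [← Real.exp_add, show -(β * (t - s)) = -(β * t) + β * s by ring]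
      calc _ ≤ C * Real.exp (-(β * t) + β * s) * ‖k‖ := by gcongr
        _ = _ := by ring
    refine hle.trans (le_of_eq ?_)
    rw [integral_const_mul, integral_const_mul, integral_exp_mul_Iic hβ]
    rw [mul_div_assoc', ← Real.exp_add]
    simp
    ring
  refine ⟨BoundedContinuousFunction.ofNormedAddCommGroup y
    (continuous_iff_continuousAt.2 fun t => (hyd t).continuousAt) _ hbound, ?_, hyd⟩
  exact BoundedContinuousFunction.norm_ofNormedAddCommGroup_le _ (by positivity) hbound

lemma exists_resolvent {B : E →L[ℝ] E} {C β : ℝ} (hB : Stable B C β) :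
    ∃ R : (ℝ →ᵇ E) →L[ℝ] (ℝ →ᵇ E), (∀ k, ‖R k‖ ≤ C / β * ‖k‖) ∧
      ∀ k t, HasDerivAt (R k) (k t - B (R k t)) t := by
  choose y hy1 hy2 using fun k => exists_bounded hB k
  have huniq : ∀ k (z : ℝ →ᵇ E), (∀ t, HasDerivAt z (k t - B (z t)) t) → z = y k := by
    intro k z hz
    ext t
    have := bounded_unique hB (fun t => z t - y k t) ‖z - y k‖
      (fun t => (z - y k).norm_coe_le_norm t) (fun t => ?_) t
    · exact sub_eq_zero.1 this
    · refine ((hz t).sub (hy2 k t)).congr_deriv ?_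
      rw [map_sub]; abel
  let R0 : (ℝ →ᵇ E) →ₗ[ℝ] (ℝ →ᵇ E) :=
    { toFun := y
      map_add' := fun a b => by
        refine (huniq _ _ fun t => ?_).symm
        refine ((hy2 a t).add (hy2 b t)).congr_deriv ?_
        simp only [BoundedContinuousFunction.coe_add, Pi.add_apply, map_add]; abel
      map_smul' := fun r a => by
        refine (huniq _ _ fun t => ?_).symm
        refine ((hy2 a t).const_smul r).congr_deriv ?_
        simp only [BoundedContinuousFunction.coe_smul, map_smul, RingHom.id_apply, smul_sub] }
  exact ⟨R0.mkContinuous (C / β) hy1, hy1, hy2⟩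

end Linear
end QPR

namespace QPR

open scoped BoundedContinuousFunction
open MeasureTheory Set Topology

lemma fixed_point {Y : Type*} [NormedAddCommGroup Y] [CompleteSpace Y] (T : Y → Y) {r : ℝ}
    (hr : 0 ≤ r)
    (hT : ∀ x y, ‖x‖ ≤ r → ‖y‖ ≤ r → ‖T x - T y‖ ≤ 1 / 2 * ‖x - y‖) (h0 : ‖T 0‖ ≤ r / 2) :
    ∃ x, ‖x‖ ≤ r ∧ ‖x‖ ≤ 2 * ‖T 0‖ ∧ T x = x := by
  have hmaps : MapsTo T (Metric.closedBall 0 r) (Metric.closedBall 0 r) := by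
    intro x hx
    rw [mem_closedBall_zero_iff] at hx ⊢
    have h1 := hT x 0 hx (by simpa using hr)
    have h2 : ‖T x‖ ≤ ‖T x - T 0‖ + ‖T 0‖ := by simpa using norm_add_le (T x - T 0) (T 0)
    rw [sub_zero] at h1
    linarith
  have hc : ContractingWith (1 / 2) (hmaps.restrict T _ _) := by
    refine ⟨by rw [← NNReal.coe_lt_coe]; norm_num, LipschitzWith.of_dist_le_mul fun x y => ?_⟩
    have := hT x y (mem_closedBall_zero_iff.1 x.2) (mem_closedBall_zero_iff.1 y.2)
    rw [Subtype.dist_eq, Subtype.dist_eq, dist_eq_norm, dist_eq_norm]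
    simpa using this
  obtain ⟨x, hx, hfx, -⟩ := hc.exists_fixedPoint' (x := 0)
    Metric.isClosed_closedBall.isComplete hmaps (by simpa using hr) (edist_ne_top _ _)
  rw [mem_closedBall_zero_iff] at hx
  refine ⟨x, hx, ?_, hfx⟩
  have h1 := hT x 0 hx (by simpa using hr)
  have h2 : ‖T x‖ ≤ ‖T x - T 0‖ + ‖T 0‖ := by simpa using norm_add_le (T x - T 0) (T 0)
  have h3 : T x = x := hfx
  rw [sub_zero] at h1
  rw [h3] at h1 h2
  linarith

section Linear

variable {E : Type*} [NormedAddCommGroup E] [NormedSpace ℝ E] [CompleteSpace E]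

/-- time translation on bounded functions -/
def shift (s : ℝ) (h : ℝ →ᵇ E) : ℝ →ᵇ E := h.compContinuous ⟨fun t => t + s, by fun_prop⟩

@[simp] lemma shift_apply (s : ℝ) (h : ℝ →ᵇ E) (t : ℝ) : shift s h t = h (t + s) := rfl

lemma resolvent_unique {B : E →L[ℝ] E} {C β : ℝ} (hB : Stable B C β)
    {R : (ℝ →ᵇ E) →L[ℝ] (ℝ →ᵇ E)} (hR : ∀ k t, HasDerivAt (R k) (k t - B (R k t)) t)
    (k z : ℝ →ᵇ E) (hz : ∀ t, HasDerivAt z (k t - B (z t)) t) : R k = z := by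
  ext t
  have := bounded_unique hB (fun t => R k t - z t) ‖R k - z‖
    (fun t => (R k - z).norm_coe_le_norm t) (fun t => ?_) t
  · exact sub_eq_zero.1 this
  · refine ((hR k t).sub (hz t)).congr_deriv ?_
    rw [map_sub]; abel

lemma resolvent_shift {B : E →L[ℝ] E} {C β : ℝ} (hB : Stable B C β)
    {R : (ℝ →ᵇ E) →L[ℝ] (ℝ →ᵇ E)} (hR : ∀ k t, HasDerivAt (R k) (k t - B (R k t)) t)
    (k : ℝ →ᵇ E) (s : ℝ) : R (shift s k) = shift s (R k) := by
  refine resolvent_unique hB hR _ _ fun t => ?_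
  exact (hR k (t + s)).comp_add_const t s

lemma resolvent_deriv {B : E →L[ℝ] E} {C β : ℝ} (hB : Stable B C β)
    {R : (ℝ →ᵇ E) →L[ℝ] (ℝ →ᵇ E)} (hR : ∀ k t, HasDerivAt (R k) (k t - B (R k t)) t)
    (G G' : ℝ →ᵇ E) (hG : ∀ t, HasDerivAt G (G' t) t) (t : ℝ) :
    R G' t = G t - B (R G t) := by
  have : R G' = G - B.compLeftContinuousBounded ℝ (R G) := by
    refine resolvent_unique hB hR _ _ fun t => ?_
    have h1 : HasDerivAt (fun t => B (R G t)) (B (G t - B (R G t))) t :=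
      B.hasFDerivAt.comp_hasDerivAt t (hR G t)
    exact (hG t).sub h1
  rw [this]; rfl

lemma form_le (P : E →L[ℝ] E →L[ℝ] ℝ) (u : E) : |P u u| ≤ ‖P‖ * ‖u‖ ^ 2 := by
  have := P.le_opNorm₂ u u
  rw [pow_two, ← mul_assoc]; exact this

set_option maxHeartbeats 1000000 in
lemma exists_linop (Γ Γi A : E →L[ℝ] E) (hΓi : Γ * Γi = 1)
    (P1 P2 : E →L[ℝ] E →L[ℝ] ℝ) (hP1 : ∀ u v, P1 u v = P1 v u) (hP2 : ∀ u v, P2 u v = P2 v u)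
    (hP12 : ∀ u v, P2 u v = P1 (Γ u) v)
    {κ1 κ2 γ a : ℝ} (hκ1 : 0 < κ1) (hκ2 : 0 < κ2) (hγ : 0 < γ) (ha : 0 < a)
    (hlow1 : ∀ u, κ1 * ‖u‖ ^ 2 ≤ P1 u u) (hlow2 : ∀ u, κ2 * ‖u‖ ^ 2 ≤ P2 u u)
    (hΓ : ∀ u, γ * P1 u u ≤ P1 (Γ u) u) (hA : ∀ u, a * ‖u‖ ^ 2 ≤ P1 (A u) u) :
    ∃ ε₁ > (0 : ℝ), ∃ K > (0 : ℝ), ∀ ε ∈ Ioo (0 : ℝ) ε₁,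
      ∃ L : (ℝ →ᵇ E) →L[ℝ] (ℝ →ᵇ E), (∀ h, ‖L h‖ ≤ K * ‖h‖) ∧
      (∀ h, ∃ v : ℝ → E, ∀ t, HasDerivAt (L h) (v t) t ∧
        HasDerivAt v (h t - ε⁻¹ • Γ (v t) - A (L h t)) t) ∧
      (∀ G G' : ℝ →ᵇ E, (∀ t, HasDerivAt G (G' t) t) → ‖L G'‖ ≤ K * ε * ‖G‖) ∧
      (∀ h s, L (shift s h) = shift s (L h)) := by
  set r : ℝ := 2 * ‖Γi * A‖ + 1 with hr
  have hr0 : 0 < r := by positivity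
  set C1 := Real.sqrt (‖P1‖ / κ1)
  set C2 := Real.sqrt (‖P2‖ / κ2)
  have hC1 : 0 ≤ C1 := Real.sqrt_nonneg _
  have hC2 : 0 ≤ C2 := Real.sqrt_nonneg _
  set b := a / (2 * (‖P2‖ + 1)) with hb
  have hb0 : 0 < b := by positivity
  -- smallness conditions
  have hsm : ∀ c η : ℝ, 0 < η → ∀ᶠ ε : ℝ in 𝓝[>] 0, ε ^ 2 * c < η := by
    intro c η hη
    have : Tendsto (fun ε : ℝ => ε ^ 2 * c) (𝓝[>] 0) (𝓝 (0 ^ 2 * c)) :=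
      ((Continuous.tendsto (by fun_prop) 0)).mono_left nhdsWithin_le_nhds
    refine this.eventually (gt_mem_nhds ?_)
    simpa using hη
  have hev := ((hsm (‖Γi‖ * (2 * r)) (1 / 2) (by norm_num)).and
    ((hsm (‖P1‖ * r ^ 2) (a / 2) (by positivity)).and
      (hsm (‖P1‖ * r / κ1) (γ / 2) (by positivity))))
  rw [eventually_nhdsWithin_iff, Metric.eventually_nhds_iff] at hev
  obtain ⟨ε₁, hε₁, hsmall⟩ := hev
  refine ⟨ε₁, hε₁, 2 * C1 / γ * (C2 / b) + (1 + r * C2 / b) * (2 * C1 / γ) + 1,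
    by positivity, fun ε hε => ?_⟩
  have hε0 : 0 < ε := hε.1
  obtain ⟨hs1, hs2, hs3⟩ := hsmall (y := ε) (by simpa [abs_of_pos hε0] using hε.2) hε0
  -- the matrix `N`
  obtain ⟨N, hNr, -, hN⟩ := fixed_point (fun N : E →L[ℝ] E => Γi * (A + ε ^ 2 • (N * N))) hr0.le
    (by
      intro x y hx hy
      have e : Γi * (A + ε ^ 2 • (x * x)) - Γi * (A + ε ^ 2 • (y * y)) =
          ε ^ 2 • (Γi * (x * (x - y) + (x - y) * y)) := by
        rw [← mul_sub, add_sub_add_left_eq_sub, ← smul_sub, mul_smul_comm]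
        congr 2
        noncomm_ring
      rw [e, norm_smul, Real.norm_of_nonneg (sq_nonneg ε)]
      have h1 : ‖x * (x - y) + (x - y) * y‖ ≤ 2 * r * ‖x - y‖ := by
        refine (norm_add_le _ _).trans ?_
        have h2 := norm_mul_le x (x - y)
        have h3 := norm_mul_le (x - y) y
        have h4 : ‖x‖ * ‖x - y‖ ≤ r * ‖x - y‖ := by gcongr
        have h5 : ‖x - y‖ * ‖y‖ ≤ ‖x - y‖ * r := by gcongr
        linarith
      calc ε ^ 2 * ‖Γi * (x * (x - y) + (x - y) * y)‖
          ≤ ε ^ 2 * (‖Γi‖ * (2 * r * ‖x - y‖)) := by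
            gcongr
            exact (norm_mul_le _ _).trans (by gcongr)
        _ = ε ^ 2 * (‖Γi‖ * (2 * r)) * ‖x - y‖ := by ring
        _ ≤ 1 / 2 * ‖x - y‖ := by gcongr)
    (by
      simp only [mul_zero, smul_zero, add_zero, hr]
      linarith)
  have hΓN : Γ * N = A + ε ^ 2 • (N * N) := by
    conv_lhs => rw [← hN]
    rw [← mul_assoc, hΓi, one_mul]
  have hΓNu : ∀ u, Γ (N u) = A u + ε ^ 2 • N (N u) := fun u => by
    have := congrArg (fun T : E →L[ℝ] E => T u) hΓN
    simpa using this
  have hNu : ∀ u, ‖N u‖ ≤ r * ‖u‖ := fun u =>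
    (N.le_opNorm u).trans (by gcongr)
  set M1 : E →L[ℝ] E := ε⁻¹ • Γ - ε • N with hM1
  set M2 : E →L[ℝ] E := ε • N with hM2
  have hP1le : ∀ x y, |P1 x y| ≤ ‖P1‖ * ‖x‖ * ‖y‖ := fun x y => P1.le_opNorm₂ x y
  have hS2 : Stable M2 C2 (ε * b) := by
    refine stable_of_form M2 P2 hP2 hκ2 (by positivity) hlow2 fun u => ?_
    have e : P2 (M2 u) u = ε * (P1 (A u) u + ε ^ 2 * P1 (N (N u)) u) := by
      rw [hP12]
      simp [hM2, hΓNu]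
      ring
    rw [e]
    have h1 := hA u
    have h2 : |P1 (N (N u)) u| ≤ ‖P1‖ * r ^ 2 * ‖u‖ ^ 2 := by
      refine (hP1le _ _).trans ?_
      calc ‖P1‖ * ‖N (N u)‖ * ‖u‖ ≤ ‖P1‖ * (r * (r * ‖u‖)) * ‖u‖ := by
            gcongr
            exact (hNu _).trans (by gcongr; exact hNu _)
        _ = _ := by ring
    have h3 := (abs_le.1 h2).1
    have h4 : b * P2 u u ≤ a / 2 * ‖u‖ ^ 2 := by
      have h5 := (le_abs_self _).trans (form_le P2 u)
      calc b * P2 u u ≤ b * (‖P2‖ * ‖u‖ ^ 2) := by gcongr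
        _ ≤ b * ((‖P2‖ + 1) * ‖u‖ ^ 2) := by gcongr; linarith
        _ = _ := by rw [hb]; field_simp
    rw [mul_assoc]
    refine mul_le_mul_of_nonneg_left ?_ hε0.le
    have h6 : ε ^ 2 * (‖P1‖ * r ^ 2) * ‖u‖ ^ 2 ≤ a / 2 * ‖u‖ ^ 2 := by gcongr
    have h7 : -(ε ^ 2 * (‖P1‖ * r ^ 2 * ‖u‖ ^ 2)) ≤ ε ^ 2 * P1 (N (N u)) u := by
      have := mul_le_mul_of_nonneg_left h3 (sq_nonneg ε)
      linarith
    linarith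
  have hS1 : Stable M1 C1 (ε⁻¹ * (γ / 2)) := by
    refine stable_of_form M1 P1 hP1 hκ1 (by positivity) hlow1 fun u => ?_
    have e : P1 (M1 u) u = ε⁻¹ * (P1 (Γ u) u - ε ^ 2 * P1 (N u) u) := by
      simp [hM1, hM2]
      field_simp
    rw [e, mul_assoc]
    refine mul_le_mul_of_nonneg_left ?_ (inv_nonneg.2 hε0.le)
    have h1 := hΓ u
    have h2 : |P1 (N u) u| ≤ ‖P1‖ * r / κ1 * P1 u u := by
      refine (hP1le _ _).trans ?_
      calc ‖P1‖ * ‖N u‖ * ‖u‖ ≤ ‖P1‖ * (r * ‖u‖) * ‖u‖ := by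
            gcongr
            exact hNu _
        _ = ‖P1‖ * r / κ1 * (κ1 * ‖u‖ ^ 2) := by field_simp
        _ ≤ _ := by gcongr; exact hlow1 u
    have h3 := (abs_le.1 h2).2
    have h0 : 0 ≤ P1 u u := (by positivity : 0 ≤ κ1 * ‖u‖ ^ 2).trans (hlow1 u)
    have h6 : ε ^ 2 * (‖P1‖ * r / κ1) * P1 u u ≤ γ / 2 * P1 u u := by gcongr
    have h7 := mul_le_mul_of_nonneg_left h3 (sq_nonneg ε)
    linarith
  obtain ⟨R1, hR1n, hR1⟩ := exists_resolvent hS1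
  obtain ⟨R2, hR2n, hR2⟩ := exists_resolvent hS2
  have hR1n' : ∀ h, ‖R1 h‖ ≤ 2 * C1 / γ * ε * ‖h‖ := fun h => by
    refine (hR1n h).trans (le_of_eq ?_)
    field_simp
  have hR2n' : ∀ h, ‖R2 h‖ ≤ C2 / b * ε⁻¹ * ‖h‖ := fun h => by
    refine (hR2n h).trans (le_of_eq ?_)
    field_simp
  refine ⟨R2.comp R1, fun h => ?_, fun h => ?_, fun G G' hG => ?_, fun h s => ?_⟩
  · calc ‖R2 (R1 h)‖ ≤ C2 / b * ε⁻¹ * ‖R1 h‖ := hR2n' _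
      _ ≤ C2 / b * ε⁻¹ * (2 * C1 / γ * ε * ‖h‖) := by gcongr; exact hR1n' _
      _ = 2 * C1 / γ * (C2 / b) * ‖h‖ := by field_simp
      _ ≤ _ := by
        gcongr
        have : 0 ≤ (1 + r * C2 / b) * (2 * C1 / γ) := by positivity
        linarith
  · refine ⟨fun t => R1 h t - M2 (R2 (R1 h) t), fun t => ⟨hR2 _ t, ?_⟩⟩
    have h1 : HasDerivAt (fun t => M2 (R2 (R1 h) t)) (M2 (R1 h t - M2 (R2 (R1 h) t))) t :=
      M2.hasFDerivAt.comp_hasDerivAt t (hR2 _ t)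
    refine ((hR1 h t).sub h1).congr_deriv ?_
    simp only [ContinuousLinearMap.comp_apply]
    generalize R2 (R1 h) t = x
    generalize R1 h t = y
    simp only [hM1, hM2, sub_apply, smul_apply, map_sub, map_smul, hΓNu]
    simp only [smul_sub, smul_add, smul_smul]
    have : ε⁻¹ * (ε * ε ^ 2) = ε * ε := by field_simp
    have h' : ε⁻¹ * ε = 1 := by field_simp
    rw [this, h', one_smul]
    abel
  · set k := R1 G with hk
    have e1 : ∀ t, HasDerivAt k (R1 G' t) t := fun t => by
      rw [resolvent_deriv hS1 hR1 G G' hG t]; exact hR1 G t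
    have e2 := resolvent_deriv hS2 hR2 k (R1 G') e1
    have hkn := hR1n' G
    rw [← hk] at hkn
    have hbd : ‖R2 (R1 G')‖ ≤ (1 + r * C2 / b) * ‖k‖ := by
      rw [BoundedContinuousFunction.norm_le (by positivity)]
      intro t
      rw [e2 t]
      have h1 := k.norm_coe_le_norm t
      have h2 : ‖M2 (R2 k t)‖ ≤ ε * (r * (C2 / b * ε⁻¹ * ‖k‖)) := by
        rw [hM2, smul_apply, norm_smul, Real.norm_of_nonneg hε0.le]
        gcongr
        refine (hNu _).trans ?_
        gcongr
        exact ((R2 k).norm_coe_le_norm t).trans (hR2n' k)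
      have h3 : ε * (r * (C2 / b * ε⁻¹ * ‖k‖)) = r * C2 / b * ‖k‖ := by field_simp
      refine (norm_sub_le _ _).trans ?_
      linarith
    calc ‖R2 (R1 G')‖ ≤ (1 + r * C2 / b) * ‖k‖ := hbd
      _ ≤ (1 + r * C2 / b) * (2 * C1 / γ * ε * ‖G‖) := by gcongr
      _ = (1 + r * C2 / b) * (2 * C1 / γ) * ε * ‖G‖ := by ring
      _ ≤ _ := by
        gcongr
        have : 0 ≤ 2 * C1 / γ * (C2 / b) := by positivity
        linarith
  · simp only [ContinuousLinearMap.comp_apply]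
    rw [resolvent_shift hS1 hR1, resolvent_shift hS2 hR2]

end Linear
end QPR

namespace QPR

open scoped BoundedContinuousFunction
open MeasureTheory Set Topology

section Nem

variable {E F : Type*} [NormedAddCommGroup E] [NormedSpace ℝ E]
  [NormedAddCommGroup F] [NormedSpace ℝ F]

/-- pointwise evaluation of a family of multilinear maps -/
def liftFun {n : ℕ} (q : ℝ →ᵇ (E [×n]→L[ℝ] F)) (u : Fin n → (ℝ →ᵇ E)) : ℝ →ᵇ F :=
  BoundedContinuousFunction.ofNormedAddCommGroup (fun t => q t (fun i => u i t))
    (by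
      have h1 : Continuous fun t => ((q t, fun i => u i t) : (E [×n]→L[ℝ] F) × (Fin n → E)) :=
        q.continuous.prodMk (continuous_pi fun i => (u i).continuous)
      exact (continuous_eval (F := E [×n]→L[ℝ] F)).comp h1)
    (‖q‖ * ∏ i, ‖u i‖)
    (fun t => by
      refine ((q t).le_opNorm _).trans ?_
      gcongr with i
      · exact q.norm_coe_le_norm t
      · exact (u i).norm_coe_le_norm t)

lemma liftFun_apply {n : ℕ} (q : ℝ →ᵇ (E [×n]→L[ℝ] F)) (u : Fin n → (ℝ →ᵇ E)) (t : ℝ) :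
    liftFun q u t = q t (fun i => u i t) := rfl

lemma norm_liftFun_le {n : ℕ} (q : ℝ →ᵇ (E [×n]→L[ℝ] F)) (u : Fin n → (ℝ →ᵇ E)) :
    ‖liftFun q u‖ ≤ ‖q‖ * ∏ i, ‖u i‖ :=
  BoundedContinuousFunction.norm_ofNormedAddCommGroup_le _ (by positivity) _

def liftMul {n : ℕ} (q : ℝ →ᵇ (E [×n]→L[ℝ] F)) : (ℝ →ᵇ E) [×n]→L[ℝ] (ℝ →ᵇ F) :=
  MultilinearMap.mkContinuous
    { toFun := liftFun q
      map_update_add' := by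
        intro _ m i x y
        ext t
        have e : ∀ z, (fun j => Function.update m i z j t) =
            Function.update (fun j => m j t) i (z t) := fun z => by
          funext j
          exact Function.apply_update (fun _ (u : ℝ →ᵇ E) => u t) m i z j
        rw [BoundedContinuousFunction.add_apply]
        simp only [liftFun_apply]
        rw [e, e, e]
        exact (q t).map_update_add _ _ _ _
      map_update_smul' := by
        intro _ m i c x
        ext t
        have e : ∀ z, (fun j => Function.update m i z j t) =
            Function.update (fun j => m j t) i (z t) := fun z => by
          funext j
          exact Function.apply_update (fun _ (u : ℝ →ᵇ E) => u t) m i z j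
        rw [BoundedContinuousFunction.smul_apply]
        simp only [liftFun_apply]
        rw [e, e]
        exact (q t).map_update_smul _ _ _ _ }
    ‖q‖ (norm_liftFun_le q)

lemma norm_liftMul_le {n : ℕ} (q : ℝ →ᵇ (E [×n]→L[ℝ] F)) : ‖liftMul q‖ ≤ ‖q‖ :=
  ContinuousMultilinearMap.opNorm_le_bound (norm_nonneg q) (norm_liftFun_le q)

lemma liftMul_apply {n : ℕ} (q : ℝ →ᵇ (E [×n]→L[ℝ] F)) (u : Fin n → (ℝ →ᵇ E)) (t : ℝ) :
    liftMul q u t = q t (fun i => u i t) := rfl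

lemma nemytskii [CompleteSpace F] (q : ∀ n, ℝ →ᵇ (E [×n]→L[ℝ] F)) {C ρ : ℝ} (hρ : 0 < ρ)
    (hq : ∀ n, ‖q n‖ ≤ C / ρ ^ n) (U : (ℝ →ᵇ E) → (ℝ →ᵇ F))
    (hU : ∀ u, ‖u‖ < ρ → ∀ t, HasSum (fun n => q n t (fun _ => u t)) (U u t)) :
    AnalyticOnNhd ℝ U (Metric.ball 0 ρ) := by
  set p : FormalMultilinearSeries ℝ (ℝ →ᵇ E) (ℝ →ᵇ F) := fun n => liftMul (q n) with hp
  lift ρ to NNReal using hρ.le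
  have hpn : ∀ n, ‖p n‖ ≤ C / (ρ : ℝ) ^ n := fun n => (norm_liftMul_le _).trans (hq n)
  have hfp : HasFPowerSeriesOnBall U p 0 ρ := by
    refine ⟨?_, by exact_mod_cast hρ, fun {u} hu => ?_⟩
    · refine p.le_radius_of_bound C fun n => ?_
      have := hpn n
      rwa [le_div_iff₀ (by positivity)] at this
    · have hu' : ‖u‖ < ρ := by
        rw [mem_eball_zero_iff] at hu
        rw [enorm_eq_nnnorm] at hu
        exact_mod_cast hu
      have hsum : Summable fun n => p n (fun _ => u) := by
        have hg : Summable fun n : ℕ => C * (‖u‖ / ρ) ^ n :=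
          (summable_geometric_of_lt_one (by positivity) ((div_lt_one hρ).2 hu')).mul_left C
        refine Summable.of_norm_bounded hg fun n => ?_
        refine ((p n).le_opNorm _).trans ?_
        simp only [Finset.prod_const, Finset.card_univ, Fintype.card_fin]
        calc ‖p n‖ * ‖u‖ ^ n ≤ C / (ρ : ℝ) ^ n * ‖u‖ ^ n := by gcongr; exact hpn n
          _ = _ := by rw [div_pow]; ring
      have e : ∑' n, p n (fun _ => u) = U u := by
        ext t
        have h1 : HasSum (fun n => p n (fun _ => u) t) ((∑' n, p n (fun _ => u)) t) :=
          hsum.hasSum.mapL (BoundedContinuousFunction.evalCLM ℝ t)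
        exact h1.unique (hU u hu' t)
      rw [zero_add, ← e]
      exact hsum.hasSum
  have := hfp.analyticOnNhd
  rwa [Metric.eball_coe] at this

end Nem

section Taylor

variable {E F : Type*} [NormedAddCommGroup E] [NormedSpace ℝ E]
  [NormedAddCommGroup F] [NormedSpace ℝ F] [CompleteSpace F]

/-- Taylor data at a point with explicit constants. -/
def TaylorAt (f : E → F) (C ρ : ℝ) (x : E) : Prop :=
  (∀ n : ℕ, ‖((n.factorial : ℝ))⁻¹ • iteratedFDeriv ℝ n f x‖ ≤ C / ρ ^ n) ∧
  ∀ y, ‖y‖ < ρ → HasSum (fun n : ℕ => ((n.factorial : ℝ)⁻¹ • iteratedFDeriv ℝ n f x) fun _ => y)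
    (f (x + y))

lemma TaylorAt.mono {f : E → F} {C ρ C' ρ' : ℝ} {x : E} (h : TaylorAt f C ρ x)
    (hC0 : 0 ≤ C) (hC : C ≤ C') (hρ' : 0 < ρ') (hρ : ρ' ≤ ρ) : TaylorAt f C' ρ' x := by
  refine ⟨fun n => (h.1 n).trans ?_, fun y hy => h.2 y (hy.trans_le hρ)⟩
  have : 0 ≤ C' := hC0.trans hC
  gcongr

lemma taylor_local {f : E → F} {x : E} (hf : AnalyticAt ℝ f x) :
    ∃ C ρ : ℝ, 0 ≤ C ∧ 0 < ρ ∧ ∀ y ∈ Metric.ball x ρ, TaylorAt f C ρ y := by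
  obtain ⟨p, R, hp⟩ := hf
  obtain ⟨ρ', hρ'0, hρ'R⟩ := ENNReal.lt_iff_exists_nnreal_btwn.1 hp.r_pos
  set ρ : NNReal := ρ' / 2 with hρ
  have hρ0 : 0 < ρ := by
    have : 0 < ρ' := by exact_mod_cast hρ'0
    positivity
  have hρρ : ((ρ : ENNReal) + ρ) < R := by
    rw [← ENNReal.coe_add, hρ, add_halves]; exact hρ'R
  have hrad : ((ρ : ENNReal) + ρ) < p.radius := hρρ.trans_le hp.r_le
  have hS := p.changeOriginSeries_summable_aux₁ hrad
  set S := ∑' s : Σ k l : ℕ, { s : Finset (Fin (k + l)) // s.card = l },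
      ‖p (s.1 + s.2.1)‖₊ * ρ ^ s.2.1 * ρ ^ s.1 with hSdef
  refine ⟨S, ρ, S.2, hρ0, fun z hz => ?_⟩
  obtain ⟨y, rfl⟩ : ∃ y, z = x + y := ⟨z - x, by abel⟩
  have hy : ‖y‖₊ < ρ := by
    rw [Metric.mem_ball, dist_eq_norm, add_sub_cancel_left] at hz
    exact_mod_cast hz
  have hyR : (‖y‖₊ : ENNReal) < R :=
    lt_of_le_of_lt (le_trans (by exact_mod_cast hy.le) le_self_add) hρρ
  have hco := hp.changeOrigin hyR
  have hbound : ∀ k, ‖p.changeOrigin y k‖₊ * ρ ^ k ≤ S := by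
    intro k
    have h1 := p.nnnorm_changeOrigin_le k (hyR.trans_le hp.r_le)
    have hsk := (NNReal.summable_sigma.1 hS).1 k
    have h2 : ∑' s : Σ l : ℕ, { s : Finset (Fin (k + l)) // s.card = l },
        ‖p (k + s.1)‖₊ * ‖y‖₊ ^ s.1 ≤ ∑' s : Σ l : ℕ, { s : Finset (Fin (k + l)) // s.card = l },
        ‖p (k + s.1)‖₊ * ρ ^ s.1 := by
      have hs2 : Summable fun s : Σ l : ℕ, { s : Finset (Fin (k + l)) // s.card = l } =>
        ‖p (k + s.1)‖₊ * ρ ^ s.1 :=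
        p.changeOriginSeries_summable_aux₂ (lt_of_le_of_lt le_self_add hrad) k
      refine Summable.tsum_le_tsum (fun s => by gcongr) ?_ hs2
      exact NNReal.summable_of_le (fun s => by gcongr) hs2
    have h3 : (∑' s : Σ l : ℕ, { s : Finset (Fin (k + l)) // s.card = l },
        ‖p (k + s.1)‖₊ * ρ ^ s.1) * ρ ^ k ≤ S := by
      rw [← NNReal.tsum_mul_right, hSdef, hS.tsum_sigma' (fun k => (NNReal.summable_sigma.1 hS).1 k)]
      exact (NNReal.summable_sigma.1 hS).2.le_tsum k (fun _ _ => zero_le)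
    refine le_trans ?_ h3
    gcongr
    exact h1.trans h2
  refine ⟨fun n => ?_, fun v hv => ?_⟩
  · have hb := hbound n
    have hb' : ‖p.changeOrigin y n‖ ≤ S / (ρ : ℝ) ^ n := by
      rw [le_div_iff₀ (by positivity)]
      exact_mod_cast hb
    have hit : ‖iteratedFDeriv ℝ n f (x + y)‖ ≤ n.factorial * ‖p.changeOrigin y n‖ := by
      refine ContinuousMultilinearMap.opNorm_le_bound (by positivity) fun v => ?_
      rw [hco.iteratedFDeriv_eq_sum_of_completeSpace]
      refine (norm_sum_le _ _).trans ?_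
      have : ∀ σ ∈ (Finset.univ : Finset (Equiv.Perm (Fin n))),
          ‖p.changeOrigin y n (fun i => v (σ i))‖ ≤ ‖p.changeOrigin y n‖ * ∏ i, ‖v i‖ := by
        intro σ _
        refine ((p.changeOrigin y n).le_opNorm _).trans (le_of_eq ?_)
        rw [Equiv.prod_comp σ (fun i => ‖v i‖)]
      refine (Finset.sum_le_sum this).trans (le_of_eq ?_)
      rw [Finset.sum_const, Finset.card_univ, Fintype.card_perm, Fintype.card_fin, nsmul_eq_mul]
      ring
    rw [norm_smul, norm_inv, Real.norm_natCast]
    have hfac : (0 : ℝ) < n.factorial := by positivity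
    rw [inv_mul_le_iff₀ hfac]
    exact hit.trans (by gcongr)
  · have hv' : v ∈ Metric.eball (0 : E) (R - ‖y‖₊) := by
      rw [mem_eball_zero_iff, enorm_eq_nnnorm]
      rw [lt_tsub_iff_right]
      refine lt_of_le_of_lt ?_ hρρ
      have : ‖v‖₊ ≤ ρ := by exact_mod_cast hv.le
      gcongr
    exact hco.hasSum_iteratedFDeriv hv'

lemma taylor_compact {f : E → F} {K : Set E} (hK : IsCompact K) (hf : ∀ x ∈ K, AnalyticAt ℝ f x) :
    ∃ C ρ : ℝ, 0 ≤ C ∧ 0 < ρ ∧ ∀ y ∈ K, TaylorAt f C ρ y := by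
  refine hK.induction_on (p := fun s => ∃ C ρ : ℝ, 0 ≤ C ∧ 0 < ρ ∧ ∀ y ∈ s, TaylorAt f C ρ y)
    ⟨0, 1, le_rfl, one_pos, by simp⟩ ?_ ?_ ?_
  · rintro s t hst ⟨C, ρ, h1, h2, h3⟩
    exact ⟨C, ρ, h1, h2, fun y hy => h3 y (hst hy)⟩
  · rintro s t ⟨C, ρ, h1, h2, h3⟩ ⟨C', ρ', h1', h2', h3'⟩
    refine ⟨max C C', min ρ ρ', le_max_of_le_left h1, lt_min h2 h2', ?_⟩
    rintro y (hy | hy)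
    · exact (h3 y hy).mono h1 (le_max_left _ _) (lt_min h2 h2') (min_le_left _ _)
    · exact (h3' y hy).mono h1' (le_max_right _ _) (lt_min h2 h2') (min_le_right _ _)
  · intro x hx
    obtain ⟨C, ρ, h1, h2, h3⟩ := taylor_local (hf x hx)
    exact ⟨_, mem_nhdsWithin_of_mem_nhds (Metric.ball_mem_nhds x h2), C, ρ, h1, h2, h3⟩

/-- The constant function embedding. -/
def constL (E : Type*) [NormedAddCommGroup E] [NormedSpace ℝ E] : E →L[ℝ] (ℝ →ᵇ E) :=
  LinearMap.mkContinuous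
    { toFun := fun y => BoundedContinuousFunction.const ℝ y
      map_add' := fun _ _ => rfl
      map_smul' := fun _ _ => rfl } 1
    (fun y => by
      rw [one_mul]
      exact (BoundedContinuousFunction.norm_le (norm_nonneg y)).2 fun t => le_rfl)

lemma translate_analytic {f : E → F} {C ρ : ℝ} (hρ : 0 < ρ)
    (hT : ∀ x, TaylorAt f C ρ x) (hcd : ∀ n : ℕ, ContDiff ℝ n f) {M : ℝ} (hM : ∀ x, ‖f x‖ ≤ M)
    (w : E) (Fr : E → (ℝ →ᵇ F)) (hFr : ∀ ψ t, Fr ψ t = f (ψ + t • w)) :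
    AnalyticOnNhd ℝ Fr univ := by
  intro ψ0 _
  have hfc : Continuous f := (hcd 0).continuous
  let q : ∀ n : ℕ, ℝ →ᵇ (E [×n]→L[ℝ] F) := fun n =>
    BoundedContinuousFunction.ofNormedAddCommGroup
      (fun t => (n.factorial : ℝ)⁻¹ • iteratedFDeriv ℝ n f (ψ0 + t • w))
      (by
        have := (hcd n).continuous_iteratedFDeriv (m := n) le_rfl
        fun_prop) (C / ρ ^ n) (fun t => (hT _).1 n)
  have hC : 0 ≤ C := by
    have := (norm_nonneg _).trans ((hT ψ0).1 0)
    simpa using this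
  let U : (ℝ →ᵇ E) → (ℝ →ᵇ F) := fun u =>
    BoundedContinuousFunction.ofNormedAddCommGroup (fun t => f (ψ0 + t • w + u t))
      (by have := u.continuous; fun_prop) M (fun t => hM _)
  have hU := nemytskii q hρ
    (fun n => BoundedContinuousFunction.norm_ofNormedAddCommGroup_le _ (by positivity) _) U
    (fun u hu t => (hT _).2 (u t) ((u.norm_coe_le_norm t).trans_lt hu))
  have e : Fr = fun ψ => U (constL E (ψ - ψ0)) := by
    funext ψ
    ext1 t
    rw [hFr]
    change _ = f (ψ0 + t • w + (ψ - ψ0))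
    congr 1; abel
  rw [e]
  have h1 : AnalyticAt ℝ (fun ψ => constL E (ψ - ψ0)) ψ0 :=
    (constL E).analyticAt _ |>.comp (analyticAt_id.sub analyticAt_const)
  refine AnalyticAt.fun_comp (g := U) ?_ h1
  refine hU _ ?_
  simpa using hρ

end Taylor
end QPR

namespace QPR

open scoped BoundedContinuousFunction
open MeasureTheory Set Topology

section Torus

variable {d : ℕ}

def proj (ψ : Fin d → ℝ) : UnitAddTorus (Fin d) := fun j => ((ψ j / (2 * π) : ℝ) : UnitAddCircle)

lemma continuous_proj : Continuous (proj : (Fin d → ℝ) → UnitAddTorus (Fin d)) := by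
  unfold proj
  refine continuous_pi fun j => ?_
  exact (AddCircle.continuous_mk' (1 : ℝ)).comp (by fun_prop)

def box (d : ℕ) : Set (Fin d → ℝ) := Set.univ.pi fun _ : Fin d => Set.Icc (0 : ℝ) (2 * π)

lemma isCompact_box : IsCompact (box d) := isCompact_univ_pi fun _ => isCompact_Icc

lemma volume_box : volume.real (box d) = (2 * π) ^ d := by
  rw [Measure.real, box, volume_pi_pi]
  simp [ENNReal.toReal_ofReal Real.pi_pos.le]

def tmean (P : C(UnitAddTorus (Fin d), ℂ)) : ℂ :=
  ((2 * π)⁻¹ ^ d : ℝ) • ∫ ψ in box d, P (proj ψ)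

lemma integrableOn_box {F : Type*} [NormedAddCommGroup F] {u : (Fin d → ℝ) → F}
    (hu : Continuous u) : IntegrableOn u (box d) :=
  hu.continuousOn.integrableOn_compact isCompact_box

lemma mFourier_proj (n : Fin d → ℤ) (ψ : Fin d → ℝ) :
    UnitAddTorus.mFourier n (proj ψ) = ∏ j, Complex.exp (Complex.I * n j * ψ j) := by
  simp only [UnitAddTorus.mFourier, ContinuousMap.coe_mk, proj]
  refine Finset.prod_congr rfl fun j _ => ?_
  rw [fourier_coe_apply]
  congr 1
  push_cast
  have : (π : ℂ) ≠ 0 := by exact_mod_cast Real.pi_ne_zero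
  field_simp

lemma integral_one (n : ℤ) :
    ∫ x in Set.Icc (0 : ℝ) (2 * π), Complex.exp (Complex.I * n * x) =
      if n = 0 then ((2 * π : ℝ) : ℂ) else 0 := by
  rw [integral_Icc_eq_integral_Ioc, ← intervalIntegral.integral_of_le (by positivity)]
  split_ifs with h
  · simp [h]
  · rw [integral_exp_mul_complex (by simp [h])]
    have : Complex.I * n * ((2 * π : ℝ) : ℂ) = n * (2 * π * Complex.I) := by push_cast; ring
    rw [this, Complex.exp_int_mul_two_pi_mul_I]
    simp

lemma tmean_mFourier (n : Fin d → ℤ) :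
    tmean (UnitAddTorus.mFourier n) = if n = 0 then 1 else 0 := by
  unfold tmean
  simp_rw [mFourier_proj]
  rw [box, volume_pi, Measure.restrict_pi_pi,
    integral_fintype_prod_eq_prod (fun j (x : ℝ) => Complex.exp (Complex.I * n j * x))]
  simp_rw [integral_one]
  split_ifs with h
  · subst h
    simp only [Pi.zero_apply, if_true, Finset.prod_const, Finset.card_univ, Fintype.card_fin]
    rw [Complex.real_smul]
    push_cast
    rw [← mul_pow, inv_mul_cancel₀, one_pow]
    have := Complex.ofReal_ne_zero.2 Real.pi_ne_zero
    simpa using this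
  · obtain ⟨j, hj⟩ := Function.ne_iff.1 h
    rw [Finset.prod_eq_zero (Finset.mem_univ j), smul_zero]
    simpa using hj

def Good (w : Fin d → ℝ) (P : C(UnitAddTorus (Fin d), ℂ)) : Prop :=
  ∃ G : C(UnitAddTorus (Fin d), ℂ), ∀ (ψ : Fin d → ℝ) (t : ℝ),
    HasDerivAt (fun s : ℝ => G (proj (ψ + s • w))) (P (proj (ψ + t • w)) - tmean P) t

lemma good_span {w : Fin d → ℝ} (hw : ∀ ν : Fin d → ℤ, ν ≠ 0 → (∑ j, w j * ν j) ≠ 0)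
    {P : C(UnitAddTorus (Fin d), ℂ)}
    (hP : P ∈ Submodule.span ℂ (Set.range (UnitAddTorus.mFourier (d := Fin d)))) : Good w P := by
  induction hP using Submodule.span_induction with
  | mem x hx =>
    obtain ⟨n, rfl⟩ := hx
    by_cases hn : n = 0
    · refine ⟨0, fun ψ t => ?_⟩
      rw [tmean_mFourier, if_pos hn, hn, UnitAddTorus.mFourier_zero]
      simpa using hasDerivAt_const t (0 : ℂ)
    · set a : ℂ := Complex.I * ((∑ j, w j * n j : ℝ) : ℂ) with ha
      have ha0 : a ≠ 0 := mul_ne_zero Complex.I_ne_zero (by exact_mod_cast hw n hn)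
      refine ⟨a⁻¹ • UnitAddTorus.mFourier n, fun ψ t => ?_⟩
      rw [tmean_mFourier, if_neg hn, sub_zero]
      have e : ∀ s : ℝ, UnitAddTorus.mFourier n (proj (ψ + s • w)) =
          Complex.exp (Complex.I * (∑ j, n j * ψ j) + a * s) := fun s => by
        rw [mFourier_proj, ← Complex.exp_sum]
        congr 1
        rw [ha]
        push_cast
        simp only [Finset.mul_sum, Finset.sum_mul]
        rw [← Finset.sum_add_distrib]
        refine Finset.sum_congr rfl fun j _ => ?_
        simp
        ring
      simp only [ContinuousMap.smul_apply, e]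
      have h1 : HasDerivAt (fun s : ℝ => Complex.I * (∑ j, n j * ψ j) + a * s) a t := by
        have := ((hasDerivAt_id t).ofReal_comp.const_mul a).const_add
          (Complex.I * (∑ j, (n j : ℂ) * ψ j))
        simpa using this
      have h2 := (h1.cexp).const_smul a⁻¹
      refine h2.congr_deriv ?_
      rw [smul_eq_mul]
      field_simp
  | zero =>
    refine ⟨0, fun ψ t => ?_⟩
    have : tmean (0 : C(UnitAddTorus (Fin d), ℂ)) = 0 := by simp [tmean]
    rw [this]
    simpa using hasDerivAt_const t (0 : ℂ)
  | add x y _ _ hx hy =>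
    obtain ⟨G, hG⟩ := hx
    obtain ⟨H, hH⟩ := hy
    refine ⟨G + H, fun ψ t => ((hG ψ t).add (hH ψ t)).congr_deriv ?_⟩
    have : tmean (x + y) = tmean x + tmean y := by
      simp only [tmean, ContinuousMap.add_apply]
      have hx : Continuous fun ψ => x (proj ψ) := x.continuous.comp continuous_proj
      have hy : Continuous fun ψ => y (proj ψ) := y.continuous.comp continuous_proj
      rw [integral_add (integrableOn_box hx) (integrableOn_box hy), smul_add]
    rw [this, ContinuousMap.add_apply]
    ring
  | smul a x _ hx =>
    obtain ⟨G, hG⟩ := hx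
    refine ⟨a • G, fun ψ t => ((hG ψ t).const_smul a).congr_deriv ?_⟩
    have : tmean (a • x) = a • tmean x := by
      simp only [tmean, ContinuousMap.smul_apply]
      rw [integral_smul, smul_comm]
    rw [this, ContinuousMap.smul_apply, smul_sub]

lemma exists_descend {φ : (Fin d → ℝ) → ℂ} (hφ : Continuous φ)
    (hper : ∀ (ψ : Fin d → ℝ) (k : Fin d → ℤ), φ (fun j => ψ j + 2 * π * k j) = φ ψ) :
    ∃ P : C(UnitAddTorus (Fin d), ℂ), ∀ ψ, P (proj ψ) = φ ψ := by
  let F : UnitAddTorus (Fin d) → ℂ := fun x => φ fun j => 2 * π * Quotient.out (x j)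
  have hpi : (2 * π) ≠ 0 := Real.two_pi_pos.ne'
  have hF : ∀ ψ, F (proj ψ) = φ ψ := fun ψ => by
    have : ∀ j, ∃ k : ℤ, 2 * π * Quotient.out (proj ψ j) = ψ j + 2 * π * k := fun j => by
      have h1 : ((Quotient.out (proj ψ j) : ℝ) : UnitAddCircle) = ((ψ j / (2 * π) : ℝ) : UnitAddCircle) :=
        Quotient.out_eq _
      rw [← sub_eq_zero, ← AddCircle.coe_sub, AddCircle.coe_eq_zero_iff] at h1
      obtain ⟨k, hk⟩ := h1
      refine ⟨k, ?_⟩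
      have h2 : Quotient.out (proj ψ j) = ψ j / (2 * π) + k := by
        have : (k : ℝ) = k • (1 : ℝ) := by simp
        rw [this, hk]
        ring
      rw [h2]
      field_simp
    choose k hk using this
    change φ _ = _
    rw [← hper ψ k]
    congr 1
    funext j
    exact hk j
  have hq : IsOpenQuotientMap (Pi.map (fun (_ : Fin d) (x : ℝ) => (x : UnitAddCircle))) :=
    IsOpenQuotientMap.piMap fun _ => QuotientAddGroup.isOpenQuotientMap_mk
  have hc : Continuous F := by
    rw [hq.isQuotientMap.continuous_iff]
    have : F ∘ Pi.map (fun (_ : Fin d) (x : ℝ) => (x : UnitAddCircle)) =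
        fun x => φ fun j => 2 * π * x j := by
      funext x
      rw [← hF]
      simp only [Function.comp]
      congr 1
      funext j
      simp only [Pi.map, proj]
      congr 1
      field_simp
    rw [this]
    fun_prop
  exact ⟨⟨F, hc⟩, hF⟩

lemma scalar_density {w : Fin d → ℝ} (hw : ∀ ν : Fin d → ℤ, ν ≠ 0 → (∑ j, w j * ν j) ≠ 0)
    {φ : (Fin d → ℝ) → ℝ} (hφ : Continuous φ)
    (hper : ∀ (ψ : Fin d → ℝ) (k : Fin d → ℤ), φ (fun j => ψ j + 2 * π * k j) = φ ψ)
    {δ : ℝ} (hδ : 0 < δ) :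
    ∃ G G' : (Fin d → ℝ) → ℝ, ∃ M : ℝ, Continuous G ∧ Continuous G' ∧ (∀ ψ, |G ψ| ≤ M) ∧
      (∀ ψ t, HasDerivAt (fun s : ℝ => G (ψ + s • w)) (G' (ψ + t • w)) t) ∧
      ∀ ψ, |φ ψ - (2 * π)⁻¹ ^ d • (∫ ψ in box d, φ ψ) - G' ψ| ≤ δ := by
  obtain ⟨Q, hQ⟩ := exists_descend (φ := fun ψ => (φ ψ : ℂ)) (by fun_prop)
    (fun ψ k => by rw [hper])
  have hmem : Q ∈ (Submodule.span ℂ (Set.range (UnitAddTorus.mFourier (d := Fin d)))).topologicalClosure := by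
    rw [UnitAddTorus.span_mFourier_closure_eq_top]; trivial
  rw [← SetLike.mem_coe, Submodule.topologicalClosure_coe, Metric.mem_closure_iff] at hmem
  obtain ⟨P, hP, hPQ⟩ := hmem (δ / 2) (by positivity)
  obtain ⟨G, hG⟩ := good_span hw hP
  have hnorm : ∀ ψ, ‖(φ ψ : ℂ) - P (proj ψ)‖ ≤ δ / 2 := fun ψ => by
    rw [← hQ, ← dist_eq_norm]
    exact (ContinuousMap.dist_apply_le_dist _).trans hPQ.le
  have hPc : Continuous fun ψ => P (proj ψ) := P.continuous.comp continuous_proj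
  have hpos : (0 : ℝ) < (2 * π) ^ d := by positivity
  have hmean : ‖(((2 * π)⁻¹ ^ d • (∫ ψ in box d, φ ψ) : ℝ) : ℂ) - tmean P‖ ≤ δ / 2 := by
    have e : (((2 * π)⁻¹ ^ d • (∫ ψ in box d, φ ψ) : ℝ) : ℂ) - tmean P =
        ((2 * π)⁻¹ ^ d : ℝ) • ∫ ψ in box d, ((φ ψ : ℂ) - P (proj ψ)) := by
      rw [integral_sub (integrableOn_box (by fun_prop)) (integrableOn_box hPc), smul_sub, tmean,
        integral_complex_ofReal]
      simp
    rw [e, norm_smul]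
    have h1 : ‖∫ ψ in box d, ((φ ψ : ℂ) - P (proj ψ))‖ ≤ δ / 2 * volume.real (box d) :=
      norm_setIntegral_le_of_norm_le_const isCompact_box.measure_lt_top (fun ψ _ => hnorm ψ)
    rw [volume_box] at h1
    rw [Real.norm_of_nonneg (by positivity)]
    calc _ ≤ (2 * π)⁻¹ ^ d * (δ / 2 * (2 * π) ^ d) := by gcongr
      _ = δ / 2 := by rw [inv_pow]; field_simp
  refine ⟨fun ψ => (G (proj ψ)).re, fun ψ => (P (proj ψ) - tmean P).re, ‖G‖, ?_, ?_, ?_, ?_, ?_⟩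
  · exact Complex.continuous_re.comp (G.continuous.comp continuous_proj)
  · exact Complex.continuous_re.comp (hPc.sub continuous_const)
  · exact fun ψ => (Complex.abs_re_le_norm _).trans (G.norm_coe_le_norm _)
  · intro ψ t
    exact (Complex.reCLM.hasFDerivAt.comp_hasDerivAt t (hG ψ t))
  · intro ψ
    set μ := (2 * π)⁻¹ ^ d • (∫ ψ in box d, φ ψ)
    have e : φ ψ - μ - (P (proj ψ) - tmean P).re =
        (((φ ψ : ℂ) - P (proj ψ)) - ((μ : ℂ) - tmean P)).re := by
      simp; ring
    rw [e]
    refine (Complex.abs_re_le_norm _).trans ((norm_sub_le _ _).trans ?_)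
    linarith [hnorm ψ]

variable {m : ℕ}

lemma vector_density {w : Fin d → ℝ} (hw : ∀ ν : Fin d → ℤ, ν ≠ 0 → (∑ j, w j * ν j) ≠ 0)
    {f : (Fin d → ℝ) → (Fin m → ℝ)} (hf : Continuous f)
    (hper : ∀ (ψ : Fin d → ℝ) (k : Fin d → ℤ), f (fun j => ψ j + 2 * π * k j) = f ψ)
    {δ : ℝ} (hδ : 0 < δ) :
    ∃ G G' : (Fin d → ℝ) → (Fin m → ℝ), ∃ M : ℝ, Continuous G ∧ Continuous G' ∧
      (∀ ψ, ‖G ψ‖ ≤ M) ∧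
      (∀ ψ t, HasDerivAt (fun s : ℝ => G (ψ + s • w)) (G' (ψ + t • w)) t) ∧
      ∀ ψ, ‖f ψ - (2 * π)⁻¹ ^ d • (∫ ψ in box d, f ψ) - G' ψ‖ ≤ δ := by
  have h := fun i : Fin m => scalar_density hw (φ := fun ψ => f ψ i)
    ((continuous_apply i).comp hf) (fun ψ k => by rw [hper]) hδ
  choose G G' M h1 h2 h3 h4 h5 using h
  refine ⟨fun ψ i => G i ψ, fun ψ i => G' i ψ, ∑ i, |M i|, continuous_pi h1, continuous_pi h2,
    fun ψ => ?_, fun ψ t => hasDerivAt_pi.2 fun i => h4 i ψ t, fun ψ => ?_⟩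
  · rw [pi_norm_le_iff_of_nonneg (by positivity)]
    intro i
    refine (h3 i ψ).trans ((le_abs_self _).trans ?_)
    exact Finset.single_le_sum (f := fun i => |M i|) (fun _ _ => abs_nonneg _) (Finset.mem_univ i)
  · rw [pi_norm_le_iff_of_nonneg hδ.le]
    intro i
    have e : (∫ ψ in box d, f ψ) i = ∫ ψ in box d, f ψ i :=
      eval_integral (fun i => (integrableOn_box ((continuous_apply i).comp hf))) i
    have := h5 i ψ
    simp only [Pi.sub_apply, Pi.smul_apply, e]
    exact this

lemma exists_rep (ψ : Fin d → ℝ) : ∃ k : Fin d → ℤ, (fun j => ψ j + 2 * π * k j) ∈ box d := by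
  refine ⟨fun j => -⌊ψ j / (2 * π)⌋, fun j _ => ?_⟩
  have h0 := Real.two_pi_pos
  have h1 := Int.floor_le (ψ j / (2 * π))
  have h2 := (Int.lt_floor_add_one (ψ j / (2 * π))).le
  rw [le_div_iff₀ h0] at h1
  rw [div_le_iff₀ h0] at h2
  constructor <;> push_cast <;> linarith

lemma periodic_taylor {f : (Fin d → ℝ) → (Fin m → ℝ)} (hf : AnalyticOnNhd ℝ f univ)
    (hper : ∀ (ψ : Fin d → ℝ) (k : Fin d → ℤ), f (fun j => ψ j + 2 * π * k j) = f ψ) :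
    ∃ C ρ : ℝ, 0 ≤ C ∧ 0 < ρ ∧ ∀ y, TaylorAt f C ρ y := by
  obtain ⟨C, ρ, hC, hρ, h⟩ := taylor_compact (isCompact_box (d := d)) (fun x _ => hf x trivial)
  refine ⟨C, ρ, hC, hρ, fun y => ?_⟩
  obtain ⟨k, hk⟩ := exists_rep y
  have h1 := h _ hk
  set v : Fin d → ℝ := fun j => 2 * π * k j with hv
  have hfv : ∀ z, f (z + v) = f z := fun z => hper z k
  have hfv' : (fun z => f (z + v)) = f := funext hfv
  change TaylorAt f C ρ (y + v) at h1
  have h2 : ∀ n : ℕ, iteratedFDeriv ℝ n f (y + v) = iteratedFDeriv ℝ n f y := fun n => by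
    rw [← iteratedFDeriv_comp_add_right, hfv']
  refine ⟨fun n => ?_, fun z hz => ?_⟩
  · rw [← h2]; exact h1.1 n
  · have := h1.2 z hz
    simp only [h2] at this
    rwa [add_right_comm, hfv] at this

lemma periodic_bounded {f : (Fin d → ℝ) → (Fin m → ℝ)} (hf : Continuous f)
    (hper : ∀ (ψ : Fin d → ℝ) (k : Fin d → ℤ), f (fun j => ψ j + 2 * π * k j) = f ψ) :
    ∃ M : ℝ, ∀ y, ‖f y‖ ≤ M := by
  obtain ⟨M, hM⟩ := (isCompact_box (d := d)).exists_bound_of_continuousOn hf.continuousOn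
  refine ⟨M, fun y => ?_⟩
  obtain ⟨k, hk⟩ := exists_rep y
  rw [← hper y k]
  exact hM _ hk

end Torus
end QPR

namespace QPR

open scoped BoundedContinuousFunction
open MeasureTheory Set Topology

section Mat

variable {m : ℕ}

def hess (m : ℕ) (V : (Fin m → ℝ) → ℝ) (c : Fin m → ℝ) :
    Matrix (Fin m) (Fin m) ℝ :=
  Matrix.of fun i j => iteratedFDeriv ℝ 2 V c ![Pi.single i 1, Pi.single j 1]

lemma pos_form (B : (Fin m → ℝ) →L[ℝ] (Fin m → ℝ) →L[ℝ] ℝ) (h : ∀ u, u ≠ 0 → 0 < B u u) :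
    ∃ κ : ℝ, 0 < κ ∧ ∀ u, κ * ‖u‖ ^ 2 ≤ B u u := by
  have hcont : Continuous fun u => B u u := by fun_prop
  by_cases hne : (Metric.sphere (0 : Fin m → ℝ) 1).Nonempty
  · obtain ⟨u0, hu0, hmin⟩ := (isCompact_sphere (0 : Fin m → ℝ) 1).exists_isMinOn hne
      hcont.continuousOn
    have hu0' : u0 ≠ 0 := by
      rintro rfl
      simp at hu0
    refine ⟨B u0 u0, h _ hu0', fun u => ?_⟩
    by_cases hu : u = 0
    · simp [hu]
    have hn : ‖u‖ ≠ 0 := norm_ne_zero_iff.2 hu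
    have hs : ‖u‖⁻¹ • u ∈ Metric.sphere (0 : Fin m → ℝ) 1 := by
      simp [norm_smul, hn]
    have := hmin hs
    simp only [mem_ofPred_eq, map_smul, smul_apply, smul_eq_mul] at this
    calc B u0 u0 * ‖u‖ ^ 2 ≤ (‖u‖⁻¹ * (‖u‖⁻¹ * B u u)) * ‖u‖ ^ 2 := by gcongr
      _ = B u u := by field_simp
  · refine ⟨1, one_pos, fun u => ?_⟩
    have hu : u = 0 := by
      by_contra hu
      refine hne ⟨‖u‖⁻¹ • u, ?_⟩
      simp [norm_smul, norm_ne_zero_iff.2 hu]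
    simp [hu]

def dotForm (m : ℕ) : (Fin m → ℝ) →L[ℝ] (Fin m → ℝ) →L[ℝ] ℝ :=
  ∑ i, (ContinuousLinearMap.proj (R := ℝ) (φ := fun _ : Fin m => ℝ) i).smulRight
    (ContinuousLinearMap.proj (R := ℝ) (φ := fun _ : Fin m => ℝ) i)

lemma dotForm_apply (u v : Fin m → ℝ) : dotForm m u v = u ⬝ᵥ v := by
  simp [dotForm, dotProduct]

def matL (M : Matrix (Fin m) (Fin m) ℝ) : (Fin m → ℝ) →L[ℝ] (Fin m → ℝ) :=
  LinearMap.toContinuousLinearMap (Matrix.toLin' M)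

lemma matL_apply (M : Matrix (Fin m) (Fin m) ℝ) (u : Fin m → ℝ) : matL M u = M.mulVec u := rfl

lemma matrix_linop (Γ : Matrix (Fin m) (Fin m) ℝ) (hΓs : Γ.IsSymm) (hΓ : Γ.PosDef)
    (A : (Fin m → ℝ) →L[ℝ] (Fin m → ℝ)) (hA : ∀ u, u ≠ 0 → 0 < A u ⬝ᵥ u) :
    ∃ ε₁ > (0 : ℝ), ∃ K > (0 : ℝ), ∀ ε ∈ Ioo 0 ε₁,
      ∃ L : (ℝ →ᵇ (Fin m → ℝ)) →L[ℝ] (ℝ →ᵇ (Fin m → ℝ)),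
        (∀ h, ‖L h‖ ≤ K * ‖h‖) ∧
        (∀ h, ∃ v : ℝ → (Fin m → ℝ), ∀ t, HasDerivAt (L h) (v t) t ∧
          HasDerivAt v (h t - ε⁻¹ • matL Γ (v t) - A (L h t)) t) ∧
        (∀ G G' : ℝ →ᵇ (Fin m → ℝ), (∀ t, HasDerivAt G (G' t) t) → ‖L G'‖ ≤ K * ε * ‖G‖) ∧
        (∀ h s, L (shift s h) = shift s (L h)) := by
  have hpos : ∀ u : Fin m → ℝ, u ≠ 0 → 0 < Γ.mulVec u ⬝ᵥ u := fun u hu => by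
    have := hΓ.dotProduct_mulVec_pos hu
    rw [dotProduct_comm]
    simpa using this
  have hsy : ∀ u v : Fin m → ℝ, Γ.mulVec u ⬝ᵥ v = Γ.mulVec v ⬝ᵥ u := fun u v => by
    rw [dotProduct_comm, Matrix.dotProduct_mulVec, ← Matrix.mulVec_transpose, hΓs.eq]
  obtain ⟨κ1, hκ1, hl1⟩ := pos_form (dotForm m) (fun u hu => by
    rw [dotForm_apply]
    exact lt_of_le_of_ne (Finset.sum_nonneg fun i _ => mul_self_nonneg _)
      (fun h => hu (dotProduct_self_eq_zero.1 h.symm)))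
  obtain ⟨κ2, hκ2, hl2⟩ := pos_form ((dotForm m).comp (matL Γ)) (fun u hu => by
    simpa [dotForm_apply, matL_apply] using hpos u hu)
  obtain ⟨a, ha, hla⟩ := pos_form ((dotForm m).comp A) (fun u hu => by
    simpa [dotForm_apply] using hA u hu)
  have hu : IsUnit Γ.det := hΓ.isUnit.map Matrix.detMonoidHom
  refine exists_linop (matL Γ) (matL Γ⁻¹) A ?_ (dotForm m) ((dotForm m).comp (matL Γ)) ?_ ?_ ?_
    (κ1 := κ1) (κ2 := κ2) (γ := κ2 / (‖dotForm m‖ + 1)) (a := a) hκ1 hκ2 (by positivity) ha hl1 hl2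
    ?_ hla
  · ext1 u
    simp only [mul_apply_eq_comp, matL_apply, Matrix.mulVec_mulVec]
    rw [Matrix.mul_nonsing_inv _ hu]
    simp
  · intro u v
    rw [dotForm_apply, dotForm_apply, dotProduct_comm]
  · intro u v
    simpa [dotForm_apply, matL_apply] using hsy u v
  · intro u v
    rfl
  · intro u
    have h1 := (le_abs_self _).trans (form_le (dotForm m) u)
    have h2 := hl2 u
    calc κ2 / (‖dotForm m‖ + 1) * dotForm m u u ≤ κ2 / (‖dotForm m‖ + 1) * (‖dotForm m‖ * ‖u‖ ^ 2) := by
          gcongr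
      _ ≤ κ2 / (‖dotForm m‖ + 1) * ((‖dotForm m‖ + 1) * ‖u‖ ^ 2) := by gcongr; linarith
      _ = κ2 * ‖u‖ ^ 2 := by field_simp
      _ ≤ _ := h2

lemma grad_analytic {V : (Fin m → ℝ) → ℝ} (hV : AnalyticOnNhd ℝ V univ)
    {g : (Fin m → ℝ) → (Fin m → ℝ)} (hg : ∀ x i, g x i = fderiv ℝ V x (Pi.single i 1)) :
    AnalyticOnNhd ℝ g univ := by
  have : g = fun x i => fderiv ℝ V x (Pi.single i 1) := by
    funext x i; exact hg x i
  rw [this]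
  refine AnalyticOnNhd.pi fun i => ?_
  intro x _
  exact ((ContinuousLinearMap.apply ℝ ℝ (Pi.single i (1 : ℝ) : Fin m → ℝ)).analyticAt _).comp
    (hV.fderiv x trivial)

lemma grad_pos {V : (Fin m → ℝ) → ℝ} (hV : AnalyticOnNhd ℝ V univ)
    {g : (Fin m → ℝ) → (Fin m → ℝ)} (hg : ∀ x i, g x i = fderiv ℝ V x (Pi.single i 1))
    {c : Fin m → ℝ} (hH : (hess m V c).PosDef) (u : Fin m → ℝ) (hu : u ≠ 0) :
    0 < fderiv ℝ g c u ⬝ᵥ u := by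
  have h1 := hH.dotProduct_mulVec_pos hu
  have hgd : DifferentiableAt ℝ g c := (grad_analytic hV hg c trivial).differentiableAt
  have hVd : DifferentiableAt ℝ (fderiv ℝ V) c := (hV.fderiv c trivial).differentiableAt
  have h2 : ∀ i, fderiv ℝ g c u i = fderiv ℝ (fderiv ℝ V) c u (Pi.single i 1) := fun i => by
    have e1 : HasFDerivAt (fun x => g x i)
        ((ContinuousLinearMap.proj (R := ℝ) (φ := fun _ : Fin m => ℝ) i).comp (fderiv ℝ g c)) c :=
      (ContinuousLinearMap.proj (R := ℝ) (φ := fun _ : Fin m => ℝ) i).hasFDerivAt.comp c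
        hgd.hasFDerivAt
    have e2 : HasFDerivAt (fun x => g x i)
        ((ContinuousLinearMap.apply ℝ ℝ (Pi.single i (1 : ℝ) : Fin m → ℝ)).comp
          (fderiv ℝ (fderiv ℝ V) c)) c := by
      have : (fun x => g x i) = fun x => fderiv ℝ V x (Pi.single i 1) := funext fun x => hg x i
      rw [this]
      exact (ContinuousLinearMap.apply ℝ ℝ (Pi.single i (1 : ℝ) : Fin m → ℝ)).hasFDerivAt.comp c
        hVd.hasFDerivAt
    exact congrArg (fun T : (Fin m → ℝ) →L[ℝ] ℝ => T u) (e1.unique e2)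
  have hus : ∀ T : (Fin m → ℝ) →L[ℝ] ℝ, T u = ∑ j, u j * T (Pi.single j 1) := fun T => by
    conv_lhs => rw [pi_eq_sum_univ' u]
    simp [map_sum]
  have h3 : fderiv ℝ g c u ⬝ᵥ u = u ⬝ᵥ (hess m V c).mulVec u := by
    simp only [dotProduct, h2, Matrix.mulVec, hess, Matrix.of_apply, iteratedFDeriv_two_apply,
      Matrix.cons_val_zero, Matrix.cons_val_one]
    have e1 : ∑ i, fderiv ℝ (fderiv ℝ V) c u (Pi.single i 1) * u i = fderiv ℝ (fderiv ℝ V) c u u := by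
      rw [hus (fderiv ℝ (fderiv ℝ V) c u)]
      exact Finset.sum_congr rfl fun i _ => mul_comm _ _
    rw [e1]
    have e2 := hus ((fderiv ℝ (fderiv ℝ V) c).flip u)
    simp only [ContinuousLinearMap.flip_apply] at e2
    rw [e2]
    refine Finset.sum_congr rfl fun i _ => ?_
    rw [hus (fderiv ℝ (fderiv ℝ V) c (Pi.single i 1))]
    congr 1
    exact Finset.sum_congr rfl fun i _ => mul_comm _ _
  rw [h3]
  simpa using h1

end Mat

section NL

variable {E : Type*} [NormedAddCommGroup E] [NormedSpace ℝ E] [FiniteDimensional ℝ E]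

/-- The higher-order part of `g` at `c`, as an operator on bounded functions. -/
lemma exists_nonlin {g : E → E} (hg : AnalyticOnNhd ℝ g univ) (c : E) :
    ∃ Q : (ℝ →ᵇ E) → (ℝ →ᵇ E), (∀ x t, Q x t = g (c + x t) - g c - fderiv ℝ g c (x t)) ∧
      (∃ ρ > (0 : ℝ), AnalyticOnNhd ℝ Q (Metric.ball 0 ρ)) ∧
      ∀ δ > (0 : ℝ), ∃ r > (0 : ℝ), ∀ x y : ℝ →ᵇ E, ‖x‖ ≤ r → ‖y‖ ≤ r →
        ‖Q x - Q y‖ ≤ δ * ‖x - y‖ := by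
  have : ProperSpace E := FiniteDimensional.proper ℝ E
  have hgc : Continuous g := by
    rw [continuous_iff_continuousAt]
    exact fun x => (hg x trivial).continuousAt
  set A := fderiv ℝ g c with hA
  have hb : ∀ x : ℝ →ᵇ E, ∃ M : ℝ, ∀ t, ‖g (c + x t)‖ ≤ M := fun x => by
    obtain ⟨M, hM⟩ := (isCompact_closedBall (0 : E) ‖x‖).exists_bound_of_continuousOn
      (f := fun y => g (c + y)) (by fun_prop)
    exact ⟨M, fun t => hM _ (by simpa using x.norm_coe_le_norm t)⟩
  choose M hM using hb
  let Qg : (ℝ →ᵇ E) → (ℝ →ᵇ E) := fun x =>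
    BoundedContinuousFunction.ofNormedAddCommGroup (fun t => g (c + x t))
      (by have := x.continuous; fun_prop) (M x) (hM x)
  let QA : (ℝ →ᵇ E) →L[ℝ] (ℝ →ᵇ E) := A.compLeftContinuousBounded ℝ
  let Q : (ℝ →ᵇ E) → (ℝ →ᵇ E) := fun x => Qg x - BoundedContinuousFunction.const ℝ (g c) - QA x
  have hQ : ∀ x t, Q x t = g (c + x t) - g c - A (x t) := fun x t => rfl
  refine ⟨Q, hQ, ?_, fun δ hδ => ?_⟩
  · obtain ⟨C, ρ, hC, hρ, hT⟩ := taylor_local (hg c trivial)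
    have hTc := hT c (Metric.mem_ball_self hρ)
    refine ⟨ρ, hρ, ?_⟩
    have h1 : AnalyticOnNhd ℝ Qg (Metric.ball 0 ρ) := by
      refine nemytskii (fun n => BoundedContinuousFunction.const ℝ
        ((n.factorial : ℝ)⁻¹ • iteratedFDeriv ℝ n g c)) hρ (C := C) (fun n => ?_) Qg ?_
      · exact (BoundedContinuousFunction.norm_const_le _).trans (hTc.1 n)
      · exact fun u hu t => hTc.2 (u t) ((u.norm_coe_le_norm t).trans_lt hu)
    exact (h1.sub analyticOnNhd_const).sub (QA.analyticOnNhd _)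
  · have hs : HasStrictFDerivAt g A c := (hg c trivial).hasStrictFDerivAt
    have h1 := hs.isLittleO.def hδ
    rw [nhds_prod_eq] at h1
    obtain ⟨r', hr', hb⟩ := Metric.eventually_nhds_iff.1 (by rwa [← nhds_prod_eq] at h1)
    refine ⟨r' / 2, by positivity, fun x y hx hy => ?_⟩
    refine (BoundedContinuousFunction.norm_le (by positivity)).2 fun t => ?_
    have hx' : ‖x t‖ < r' := (x.norm_coe_le_norm t).trans_lt (by linarith)
    have hy' : ‖y t‖ < r' := (y.norm_coe_le_norm t).trans_lt (by linarith)
    have h2 := hb (y := (c + x t, c + y t)) (by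
      rw [Prod.dist_eq]
      simp [dist_eq_norm, hx', hy'])
    simp only [add_sub_add_left_eq_sub] at h2
    rw [BoundedContinuousFunction.sub_apply, hQ, hQ]
    have e : g (c + x t) - g c - A (x t) - (g (c + y t) - g c - A (y t)) =
      g (c + x t) - g (c + y t) - A (x t - y t) := by rw [map_sub]; abel
    rw [e]
    refine h2.trans ?_
    gcongr
    exact (x - y).norm_coe_le_norm t

end NL
end QPR

namespace QPR

open scoped BoundedContinuousFunction
open MeasureTheory Set Topology

section Core

variable {B : Type*} [NormedAddCommGroup B] [NormedSpace ℝ B] [CompleteSpace B]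

lemma core_exists (L : B →L[ℝ] B) (Q : B → B) (hQ0 : Q 0 = 0) {r : ℝ} (hr : 0 < r)
    (hlip : ∀ x y, ‖x‖ ≤ r → ‖y‖ ≤ r → ‖L (Q x) - L (Q y)‖ ≤ 1 / 2 * ‖x - y‖)
    (h : B) (hh : ‖L h‖ ≤ r / 4) : ∃ x, ‖x‖ ≤ 2 * ‖L h‖ ∧ x = L (h - Q x) := by
  obtain ⟨x, -, h2, h3⟩ := fixed_point (fun x => L (h - Q x)) hr.le (fun x y hx hy => by
    have e : L (h - Q x) - L (h - Q y) = -(L (Q x) - L (Q y)) := by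
      simp only [map_sub]; abel
    rw [e, norm_neg]
    exact hlip x y hx hy) (by
      rw [hQ0, sub_zero]; linarith)
  rw [hQ0, sub_zero] at h2
  exact ⟨x, h2, h3.symm⟩

lemma core_unique (L : B →L[ℝ] B) (Q : B → B) {r : ℝ}
    (hlip : ∀ x y, ‖x‖ ≤ r → ‖y‖ ≤ r → ‖L (Q x) - L (Q y)‖ ≤ 1 / 2 * ‖x - y‖)
    {h h' x x' : B} (hx : ‖x‖ ≤ r) (hx' : ‖x'‖ ≤ r) (he : x = L (h - Q x))
    (he' : x' = L (h' - Q x')) : ‖x - x'‖ ≤ 2 * ‖L (h - h')‖ := by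
  have e : x - x' = L (h - h') - (L (Q x) - L (Q x')) := by
    conv_lhs => rw [he, he']
    simp only [map_sub]; abel
  have h1 : ‖x - x'‖ ≤ ‖L (h - h')‖ + ‖L (Q x) - L (Q x')‖ := by
    conv_lhs => rw [e]
    exact norm_sub_le _ _
  have := hlip x x' hx hx'
  linarith

lemma core_analytic {D : Type*} [NormedAddCommGroup D] [NormedSpace ℝ D]
    (L : B →L[ℝ] B) (Q : B → B) {r ρ : ℝ} (hr : 0 < r) (hrρ : r ≤ ρ)
    (hQ : AnalyticOnNhd ℝ Q (Metric.ball 0 ρ))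
    (hlip : ∀ x y, ‖x‖ ≤ r → ‖y‖ ≤ r → ‖L (Q x) - L (Q y)‖ ≤ 1 / 2 * ‖x - y‖)
    (h x : D → B) (hh : AnalyticOnNhd ℝ h univ) (hx : ∀ ψ, ‖x ψ‖ ≤ r / 2)
    (he : ∀ ψ, x ψ = L (h ψ - Q (x ψ))) : AnalyticOnNhd ℝ x univ := by
  intro ψ0 _
  have hx0 : ‖x ψ0‖ < r := (hx ψ0).trans_lt (by linarith)
  have hcont : ContinuousAt x ψ0 := by
    have h1 : Tendsto (fun ψ => 2 * ‖L (h ψ - h ψ0)‖) (𝓝 ψ0) (𝓝 0) := by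
      have hc : ContinuousAt h ψ0 := (hh ψ0 trivial).continuousAt
      have : ContinuousAt (fun ψ => 2 * ‖L (h ψ - h ψ0)‖) ψ0 := by fun_prop
      simpa [ContinuousAt] using this
    rw [ContinuousAt, tendsto_iff_norm_sub_tendsto_zero]
    refine squeeze_zero (fun _ => norm_nonneg _) (fun ψ => ?_) h1
    exact core_unique L Q hlip ((hx ψ).trans (by linarith)) hx0.le (he ψ) (he ψ0)
  have hLQ : AnalyticAt ℝ (fun y => L (Q y)) (x ψ0) :=
    (L.analyticAt _).comp (hQ (x ψ0) (by simpa using hx0.trans_le hrρ))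
  set R := fderiv ℝ (fun y => L (Q y)) (x ψ0) with hR
  have hRd : HasFDerivAt (fun y => L (Q y)) R (x ψ0) := hLQ.differentiableAt.hasFDerivAt
  have hRn : ‖R‖ ≤ 1 / 2 := by
    refine hRd.le_of_lip' (by norm_num) ?_
    have : ∀ᶠ y in 𝓝 (x ψ0), ‖y‖ < r := continuous_norm.continuousAt.eventually_lt_const hx0
    filter_upwards [this] with y hy
    exact hlip _ _ hy.le hx0.le
  let un : (B →L[ℝ] B)ˣ := Units.oneSub (-R) (by rw [norm_neg]; linarith)
  let e : B ≃L[ℝ] B := ContinuousLinearEquiv.ofUnit un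
  let Φ : B → B := fun y => y + L (Q y)
  have hΦa : AnalyticAt ℝ Φ (x ψ0) := analyticAt_id.add hLQ
  have hΦd : HasFDerivAt Φ (e : B →L[ℝ] B) (x ψ0) := by
    have h1 : (e : B →L[ℝ] B) = ContinuousLinearMap.id ℝ B + R := by
      change (1 : B →L[ℝ] B) - (-R) = _
      rw [sub_neg_eq_add]; rfl
    rw [h1]
    exact (hasFDerivAt_id _).add hRd
  have hΦc : ContDiffAt ℝ ⊤ Φ (x ψ0) := hΦa.contDiffAt
  have hinv := (hΦc.to_localInverse hΦd (by simp)).analyticAt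
  have hleft := (hΦc.hasStrictFDerivAt' hΦd (by simp)).eventually_left_inverse
  have hΦx : ∀ ψ, Φ (x ψ) = L (h ψ) := fun ψ => by
    change x ψ + L (Q (x ψ)) = _
    have := he ψ
    rw [map_sub] at this
    exact eq_sub_iff_add_eq.1 this
  have hev := hcont.eventually hleft
  have hfin : AnalyticAt ℝ (fun ψ => hΦc.localInverse hΦd (by simp) (L (h ψ))) ψ0 := by
    refine AnalyticAt.fun_comp (g := hΦc.localInverse hΦd (by simp)) (f := fun ψ => L (h ψ)) ?_
      ((L.analyticAt _).comp (hh ψ0 trivial))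
    rw [← hΦx]
    exact hinv
  refine hfin.congr ?_
  filter_upwards [hev] with ψ hψ
  rw [← hΦx]
  exact hψ

end Core

section Final

variable {m d : ℕ}

/-- The solution for one fixed value of `ε`. -/
lemma one_eps (w : Fin d → ℝ) (Γ : Matrix (Fin m) (Fin m) ℝ)
    (g : (Fin m → ℝ) → (Fin m → ℝ)) (f : (Fin d → ℝ) → (Fin m → ℝ))
    (hper : ∀ (ψ : Fin d → ℝ) (k : Fin d → ℤ), f (fun j => ψ j + 2 * π * k j) = f ψ)
    (c : Fin m → ℝ) (Q : (ℝ →ᵇ (Fin m → ℝ)) → (ℝ →ᵇ (Fin m → ℝ)))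
    (hQ : ∀ x t, Q x t = g (c + x t) - g c - fderiv ℝ g c (x t))
    {r ρ : ℝ} (hr : 0 < r) (hrρ : r ≤ ρ) (hQa : AnalyticOnNhd ℝ Q (Metric.ball 0 ρ))
    (h : (Fin d → ℝ) → (ℝ →ᵇ (Fin m → ℝ))) (hh : ∀ ψ t, h ψ t = f (ψ + t • w) - g c)
    (hha : AnalyticOnNhd ℝ h univ) {ε : ℝ} (hε : 0 < ε)
    (L : (ℝ →ᵇ (Fin m → ℝ)) →L[ℝ] (ℝ →ᵇ (Fin m → ℝ)))
    (hL : ∀ h, ∃ v : ℝ → (Fin m → ℝ), ∀ t, HasDerivAt (L h) (v t) t ∧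
          HasDerivAt v (h t - ε⁻¹ • matL Γ (v t) - fderiv ℝ g c (L h t)) t)
    (hsh : ∀ h s, L (shift s h) = shift s (L h))
    (hlip : ∀ x y, ‖x‖ ≤ r → ‖y‖ ≤ r → ‖L (Q x) - L (Q y)‖ ≤ 1 / 2 * ‖x - y‖)
    (hsmall : ∀ ψ, ‖L (h ψ)‖ ≤ r / 4) :
    ∃ X : (Fin d → ℝ) → (Fin m → ℝ), AnalyticOnNhd ℝ X univ ∧
      (∀ (ψ : Fin d → ℝ) (k : Fin d → ℤ), X (fun j => ψ j + 2 * π * k j) = X ψ) ∧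
      (∀ t : ℝ,
          ε • deriv (deriv fun s : ℝ => c + X fun j => w j * s) t
            + Γ.mulVec (deriv (fun s : ℝ => c + X fun j => w j * s) t)
            + ε • g (c + X fun j => w j * t)
          = ε • f fun j => w j * t) ∧
      ∀ ψ, ‖X ψ‖ ≤ 2 * ‖L (h ψ)‖ := by
  have hQ0 : Q 0 = 0 := by ext1 t; simp [hQ]
  choose x hx1 hx2 using fun ψ => core_exists L Q hQ0 hr hlip (h ψ) (hsmall ψ)
  have hx3 : ∀ ψ, ‖x ψ‖ ≤ r / 2 := fun ψ => (hx1 ψ).trans (by linarith [hsmall ψ])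
  have hx4 : ∀ ψ, ‖x ψ‖ ≤ r := fun ψ => (hx3 ψ).trans (by linarith)
  have huniq : ∀ ψ y, ‖y‖ ≤ r → y = L (h ψ - Q y) → x ψ = y := fun ψ y hy hye => by
    have := core_unique L Q hlip (hx4 ψ) hy (hx2 ψ) hye
    rw [sub_self, map_zero, norm_zero, mul_zero] at this
    exact sub_eq_zero.1 (norm_le_zero_iff.1 this)
  have hxa := core_analytic L Q hr hrρ hQa hlip h x hha hx3 hx2
  have hhper : ∀ (ψ : Fin d → ℝ) (k : Fin d → ℤ), h (fun j => ψ j + 2 * π * k j) = h ψ := by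
    intro ψ k
    ext1 t
    rw [hh, hh, ← hper (ψ + t • w) k]
    congr 2
    funext j
    simp only [Pi.add_apply]
    ring
  have hflow : ∀ ψ s, x (ψ + s • w) = shift s (x ψ) := by
    intro ψ s
    refine huniq _ _ ?_ ?_
    · refine (BoundedContinuousFunction.norm_le hr.le).2 fun t => ?_
      exact ((x ψ).norm_coe_le_norm _).trans (hx4 ψ)
    · have e : h (ψ + s • w) - Q (shift s (x ψ)) = shift s (h ψ - Q (x ψ)) := by
        ext1 t
        simp only [BoundedContinuousFunction.sub_apply, shift_apply, hQ, hh]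
        rw [add_assoc ψ, ← add_smul, add_comm s t]
      rw [e, hsh, ← hx2]
  have hX : ∀ s : ℝ, x (fun j => w j * s) 0 = x 0 s := fun s => by
    have := hflow 0 s
    have e : (fun j => w j * s) = 0 + s • w := by
      funext j
      simp [mul_comm]
    rw [e, this, shift_apply, zero_add]
  refine ⟨fun ψ => x ψ 0, ?_, ?_, ?_, ?_⟩
  · intro ψ _
    exact ((BoundedContinuousFunction.evalCLM ℝ (0 : ℝ)).analyticAt (x ψ)).comp (hxa ψ trivial)
  · intro ψ k
    have : x (fun j => ψ j + 2 * π * k j) = x ψ := by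
      refine huniq _ _ (hx4 ψ) ?_
      rw [hhper]
      exact hx2 ψ
    simp only [this]
  · intro t
    obtain ⟨v, hv⟩ := hL (h 0 - Q (x 0))
    rw [← hx2 0] at hv
    simp only [hX]
    have h1 : (deriv fun s : ℝ => c + x 0 s) = v := by
      funext s
      exact ((hv s).1.const_add c).deriv
    rw [h1, (hv t).2.deriv]
    have e : (fun j => w j * t) = 0 + t • w := by
      funext j
      simp [mul_comm]
    simp only [BoundedContinuousFunction.sub_apply, hQ, hh, matL_apply, e, smul_sub]
    rw [smul_inv_smul₀ hε.ne']
    abel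
  · intro ψ
    exact ((x ψ).norm_coe_le_norm 0).trans (hx1 ψ)

theorem final
    (w : Fin d → ℝ) (hw : ∀ ν : Fin d → ℤ, ν ≠ 0 → (∑ j, w j * ν j) ≠ 0)
    (Γ : Matrix (Fin m) (Fin m) ℝ) (hΓsymm : Γ.IsSymm) (hΓpos : Γ.PosDef)
    (V : (Fin m → ℝ) → ℝ) (hV : AnalyticOnNhd ℝ V Set.univ)
    (g : (Fin m → ℝ) → (Fin m → ℝ))
    (hg : ∀ x i, g x i = fderiv ℝ V x (Pi.single i 1))
    (f : (Fin d → ℝ) → (Fin m → ℝ))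
    (hper : ∀ (ψ : Fin d → ℝ) (k : Fin d → ℤ), f (fun j => ψ j + 2 * π * k j) = f ψ)
    (hfan : AnalyticOnNhd ℝ f Set.univ)
    (c : Fin m → ℝ) (hc : g c = (2 * π)⁻¹ ^ d • ∫ ψ in box d, f ψ)
    (hhess : (hess m V c).PosDef) :
    ∃ ε₀ > (0 : ℝ), ∃ X : ℝ → (Fin d → ℝ) → (Fin m → ℝ),
      (∀ ε ∈ Set.Ioo (0 : ℝ) ε₀,
        AnalyticOnNhd ℝ (X ε) Set.univ ∧
        (∀ (ψ : Fin d → ℝ) (k : Fin d → ℤ), X ε (fun j => ψ j + 2 * π * k j) = X ε ψ) ∧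
        ∀ t : ℝ,
          ε • deriv (deriv fun s : ℝ => c + X ε fun j => w j * s) t
            + Γ.mulVec (deriv (fun s : ℝ => c + X ε fun j => w j * s) t)
            + ε • g (c + X ε fun j => w j * t)
          = ε • f fun j => w j * t) ∧
      Tendsto (fun ε : ℝ => ⨆ ψ : Fin d → ℝ, ‖X ε ψ‖)
        (nhdsWithin 0 (Set.Ioi 0)) (nhds 0) := by
  have hga := grad_analytic hV hg
  have hfc : Continuous f := by
    rw [continuous_iff_continuousAt]
    exact fun x => (hfan x trivial).continuousAt
  have hfcd : ∀ n : ℕ, ContDiff ℝ n f := fun n => by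
    rw [contDiff_iff_contDiffAt]
    exact fun x => (hfan x trivial).contDiffAt
  obtain ⟨Q, hQ, ⟨ρ, hρ, hQa⟩, hQl⟩ := exists_nonlin hga c
  obtain ⟨M, hM⟩ := periodic_bounded hfc hper
  obtain ⟨C, ρ', -, hρ', hT⟩ := periodic_taylor hfan hper
  obtain ⟨ε₁, hε₁, K, hK, hL⟩ := matrix_linop Γ hΓsymm hΓpos (fderiv ℝ g c)
    (fun u hu => grad_pos hV hg hhess u hu)
  obtain ⟨r0, hr0, hr0l⟩ := hQl (1 / (2 * K)) (by positivity)
  set r := min r0 ρ with hr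
  have hrpos : 0 < r := lt_min hr0 hρ
  let Fr : (Fin d → ℝ) → (ℝ →ᵇ (Fin m → ℝ)) := fun ψ =>
    BoundedContinuousFunction.ofNormedAddCommGroup (fun t => f (ψ + t • w))
      (by fun_prop) M (fun t => hM _)
  have hFr : AnalyticOnNhd ℝ Fr univ :=
    translate_analytic hρ' hT hfcd hM w Fr (fun ψ t => rfl)
  let h : (Fin d → ℝ) → (ℝ →ᵇ (Fin m → ℝ)) := fun ψ => Fr ψ - BoundedContinuousFunction.const ℝ (g c)
  have hh : ∀ ψ t, h ψ t = f (ψ + t • w) - g c := fun ψ t => rfl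
  have hha : AnalyticOnNhd ℝ h univ := hFr.sub analyticOnNhd_const
  have hsmall : ∀ η : ℝ, 0 < η → ∃ e : ℝ, 0 < e ∧ ∀ ε ∈ Ioo 0 e,
      ∀ L : (ℝ →ᵇ (Fin m → ℝ)) →L[ℝ] (ℝ →ᵇ (Fin m → ℝ)), (∀ h, ‖L h‖ ≤ K * ‖h‖) →
      (∀ G G' : ℝ →ᵇ (Fin m → ℝ), (∀ t, HasDerivAt G (G' t) t) → ‖L G'‖ ≤ K * ε * ‖G‖) →
      ∀ ψ, ‖L (h ψ)‖ ≤ η := by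
    intro η hη
    obtain ⟨G, G', N, hG1, hG2, hG3, hG4, hG5⟩ :=
      vector_density hw hfc hper (δ := η / (2 * K)) (by positivity)
    have hN : 0 ≤ N := (norm_nonneg _).trans (hG3 0)
    refine ⟨η / (2 * K * (N + 1)), by positivity, ?_⟩
    rintro ε ⟨hε0, hε⟩ L hL1 hL2 ψ
    let Gb : ℝ →ᵇ (Fin m → ℝ) := BoundedContinuousFunction.ofNormedAddCommGroup
      (fun t => G (ψ + t • w)) (by fun_prop) N (fun t => hG3 _)
    let eb : ℝ →ᵇ (Fin m → ℝ) := BoundedContinuousFunction.ofNormedAddCommGroup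
      (fun t => f (ψ + t • w) - g c - G' (ψ + t • w)) (by fun_prop) (η / (2 * K)) (fun t => by
        rw [hc]; exact hG5 _)
    have heb : ‖eb‖ ≤ η / (2 * K) :=
      BoundedContinuousFunction.norm_ofNormedAddCommGroup_le _ (by positivity) _
    have hGb : ‖Gb‖ ≤ N := BoundedContinuousFunction.norm_ofNormedAddCommGroup_le _ hN _
    have h1 := hL2 Gb (h ψ - eb) (fun t => by
      refine (hG4 ψ t).congr_deriv ?_
      change G' (ψ + t • w) = (f (ψ + t • w) - g c) - (f (ψ + t • w) - g c - G' (ψ + t • w))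
      abel)
    have h2 := hL1 eb
    have h3 : ‖L (h ψ)‖ ≤ ‖L (h ψ - eb)‖ + ‖L eb‖ := by
      have := norm_add_le (L (h ψ - eb)) (L eb)
      rwa [← map_add, sub_add_cancel] at this
    have h4 : K * ‖eb‖ ≤ η / 2 := by
      calc K * ‖eb‖ ≤ K * (η / (2 * K)) := by gcongr
        _ = η / 2 := by field_simp
    have h5 : K * ε * ‖Gb‖ ≤ η / 2 := by
      calc K * ε * ‖Gb‖ ≤ K * (η / (2 * K * (N + 1))) * (N + 1) := by
            gcongr
            linarith
        _ = η / 2 := by field_simp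
    linarith
  choose e he0 he using hsmall
  have hr4 : 0 < r / 4 := by positivity
  have hone : ∀ ε ∈ Ioo 0 (min ε₁ (e (r / 4) hr4)), ∃ X : (Fin d → ℝ) → (Fin m → ℝ),
      (AnalyticOnNhd ℝ X univ ∧
      (∀ (ψ : Fin d → ℝ) (k : Fin d → ℤ), X (fun j => ψ j + 2 * π * k j) = X ψ) ∧
      (∀ t : ℝ,
          ε • deriv (deriv fun s : ℝ => c + X fun j => w j * s) t
            + Γ.mulVec (deriv (fun s : ℝ => c + X fun j => w j * s) t)
            + ε • g (c + X fun j => w j * t)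
          = ε • f fun j => w j * t)) ∧
      ∀ η (hη : 0 < η), ε < e η hη → ∀ ψ, ‖X ψ‖ ≤ 2 * η := by
    rintro ε ⟨hε0, hε⟩
    obtain ⟨L, hL1, hL2, hL3, hL4⟩ := hL ε ⟨hε0, hε.trans_le (min_le_left _ _)⟩
    obtain ⟨X, hX1, hX2, hX3, hX4⟩ := one_eps w Γ g f hper c Q hQ hrpos (min_le_right _ _) hQa h hh
      hha hε0 L hL2 hL4 (fun x y hx hy => by
        rw [← map_sub]
        refine (hL1 _).trans ?_
        have := hr0l x y (hx.trans (min_le_left _ _)) (hy.trans (min_le_left _ _))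
        calc K * ‖Q x - Q y‖ ≤ K * (1 / (2 * K) * ‖x - y‖) := by gcongr
          _ = 1 / 2 * ‖x - y‖ := by field_simp)
      (he _ hr4 ε ⟨hε0, hε.trans_le (min_le_right _ _)⟩ L hL1 hL3)
    refine ⟨X, ⟨hX1, hX2, hX3⟩, fun η hη hεη ψ => (hX4 ψ).trans ?_⟩
    have := he η hη ε ⟨hε0, hεη⟩ L hL1 hL3 ψ
    linarith
  have hE : 0 < min ε₁ (e (r / 4) hr4) := lt_min hε₁ (he0 _ _)
  choose! X hX hXs using hone
  refine ⟨_, hE, X, hX, ?_⟩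
  rw [Metric.tendsto_nhds]
  intro η hη
  have hη4 : 0 < η / 4 := by positivity
  have hpos : 0 < min (min ε₁ (e (r / 4) hr4)) (e (η / 4) hη4) := lt_min hE (he0 _ _)
  filter_upwards [Ioo_mem_nhdsGT hpos] with ε hε
  have hb := hXs ε ⟨hε.1, hε.2.trans_le (min_le_left _ _)⟩ (η / 4) hη4
    (hε.2.trans_le (min_le_right _ _))
  rw [Real.dist_eq, sub_zero, abs_of_nonneg (Real.iSup_nonneg fun _ => norm_nonneg _)]
  exact (ciSup_le hb).trans_lt (by linarith)

end Final
end QPR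

theorem forced_quasiperiodic_response_solution
    (m d : ℕ) (hm : 1 ≤ m) (hd : 1 ≤ d)
    (ω : Fin d → ℝ) (hω : ∀ ν : Fin d → ℤ, ν ≠ 0 → (∑ j, ω j * ν j) ≠ 0)
    (Γ : Matrix (Fin m) (Fin m) ℝ) (hΓsymm : Γ.IsSymm) (hΓpos : Γ.PosDef)
    (V : (Fin m → ℝ) → ℝ) (hV : AnalyticOnNhd ℝ V Set.univ)
    (g : (Fin m → ℝ) → (Fin m → ℝ))
    (hg : ∀ x i, g x i = fderiv ℝ V x (Pi.single i 1))
    (f : (Fin d → ℝ) → (Fin m → ℝ))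
    (hfper : IsPeriodic2pi d m f) (hfan : AnalyticOnNhd ℝ f Set.univ)
    (c : Fin m → ℝ) (hc : g c = boxMean d m f)
    (hhess : (hessianMatrix m V c).PosDef) :
    ∃ ε₀ > (0 : ℝ), ∃ X : ℝ → (Fin d → ℝ) → (Fin m → ℝ),
      (∀ ε ∈ Set.Ioo (0 : ℝ) ε₀,
        AnalyticOnNhd ℝ (X ε) Set.univ ∧ IsPeriodic2pi d m (X ε) ∧
        ∀ t : ℝ,
          ε • deriv (deriv fun s : ℝ => c + X ε fun j => ω j * s) t
            + Γ.mulVec (deriv (fun s : ℝ => c + X ε fun j => ω j * s) t)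
            + ε • g (c + X ε fun j => ω j * t)
          = ε • f fun j => ω j * t) ∧
      Tendsto (fun ε : ℝ => ⨆ ψ : Fin d → ℝ, ‖X ε ψ‖)
        (nhdsWithin 0 (Set.Ioi 0)) (nhds 0) := by
  exact QPR.final ω hω Γ hΓsymm hΓpos V hV g hg f hfper hfan c hc hhess

end
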